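/- Let n ∈ ℕ, E a complex Banach space, s ∈ ℝ, 0 < p ≤ ∞, 0 < q ≤ ∞, a > n/p, and let S ∈ ℤ with S ≥ −1 and S ≥ ⌊s⌋. Let ε > 0 and Ψ, ψ ∈ S(ℝ^n) satisfy |Ψ(x)| > 0 for |x| < 2ε, |ψ(x)| > 0 for ε/2 < |x| < 2ε, and D^α ψ(0) = 0 for all multi-indices |α| ≤ S. Then there exist constants c₁, c₂ > 0 such that for all f ∈ B^s_{p,q}(E): c₁ ‖f|B^s_{p,q}(E)‖ ≤ ‖(Ψ*f)_a|L_p‖ + (Σ_{j≥1} 2^{jsq} ‖(ψ_j^* f)_a|L_p‖^q)^{1/q} ≤ c₂ ‖f|B^s_{p,q}(E)‖ (supremum over j if q = ∞). Moreover, an f ∈ S'(ℝ^n,E) belongs to B^s_{p,q}(E) if and only if ‖(Ψ*f)_a|L_p‖ + (Σ_{j≥1} 2^{jsq} ‖(ψ_j^* f)_a|L_p‖^q)^{1/q} < ∞. -/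

import Mathlib

noncomputable section

open MeasureTheory Filter Metric Real Set SchwartzMap
open scoped ENNReal NNReal Topology FourierTransform

/-- Euclidean space ℝⁿ. -/
abbrev Rn (n : ℕ) : Type := EuclideanSpace ℝ (Fin n)

/-- The Schwartz space 𝓢(ℝⁿ, ℂ). -/
abbrev Sch (n : ℕ) : Type := SchwartzMap (Rn n) ℂ

/-- Partial derivative in the `i`-th coordinate direction. -/
def pd {F : Type*} [NormedAddCommGroup F] [NormedSpace ℝ F] {n : ℕ} (i : Fin n)
    (g : Rn n → F) : Rn n → F :=
  fun x => lineDeriv ℝ g x (EuclideanSpace.single i (1 : ℝ))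

/-- Multi-index derivative `D^α = ∂₁^{α₁} ⋯ ∂ₙ^{αₙ}`. -/
def mderiv {F : Type*} [NormedAddCommGroup F] [NormedSpace ℝ F] {n : ℕ} (α : Fin n → ℕ)
    (g : Rn n → F) : Rn n → F :=
  (List.finRange n).foldr (fun i h => (pd i)^[α i] h) g

/-- The order `|α|` of a multi-index. -/
def mdeg {n : ℕ} (α : Fin n → ℕ) : ℕ := ∑ i, α i

/-- The Schwartz seminorm `‖φ‖_{K,L} = sup_x (1+|x|²)^{K/2} ∑_{|α| ≤ L} |D^α φ(x)|`. -/
def schSemi {n : ℕ} (K L : ℕ) (φ : Sch n) : ℝ :=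
  ⨆ x : Rn n, (1 + ‖x‖ ^ 2) ^ ((K : ℝ) / 2) *
    ∑ α : Fin n → Fin (L + 1), if mdeg (fun i => (α i : ℕ)) ≤ L
      then ‖mderiv (fun i => (α i : ℕ)) (fun y => φ y) x‖ else 0

/-- `E`-valued tempered distributions: linear maps `𝓢(ℝⁿ) → E` bounded by some
Schwartz seminorm. -/
structure TDist (n : ℕ) (E : Type*) [NormedAddCommGroup E] [NormedSpace ℂ E] where
  toFun : Sch n →ₗ[ℂ] E
  bound : ∃ (c : ℝ) (K L : ℕ), ∀ φ : Sch n, ‖toFun φ‖ ≤ c * schSemi K L φ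

namespace Aux

lemma hasTemperateGrowth_sub_left {n : ℕ} (x : Rn n) :
    Function.HasTemperateGrowth (fun y : Rn n => x - y) := by
  apply Function.HasTemperateGrowth.of_fderiv (k := 1) (C := ‖x‖ + 1)
  · have h : (fderiv ℝ (fun y : Rn n => x - y)) =
        fun _ : Rn n => -(ContinuousLinearMap.id ℝ (Rn n)) := by
      ext1 y
      rw [fderiv_const_sub]
      simp
    rw [h]
    exact .const _
  · exact (differentiable_const x).sub differentiable_id
  · intro y
    have h1 : ‖x - y‖ ≤ ‖x‖ + ‖y‖ := norm_sub_le x y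
    have h2 : (0:ℝ) ≤ ‖y‖ := norm_nonneg y
    have h3 : (0:ℝ) ≤ ‖x‖ := norm_nonneg x
    calc ‖x - y‖ ≤ ‖x‖ + ‖y‖ := h1
      _ ≤ (‖x‖ + 1) * (1 + ‖y‖) ^ 1 := by nlinarith

lemma antilipschitz_sub_left {n : ℕ} (x : Rn n) :
    AntilipschitzWith 1 (fun y : Rn n => x - y) := by
  refine (Isometry.antilipschitz ?_)
  intro y z
  simp only [edist_dist, dist_eq_norm, sub_sub_sub_cancel_left, norm_sub_rev]

end Aux

/-- The Schwartz function `y ↦ ψ(x - y)`. -/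
def shiftReflect {n : ℕ} (ψ : Sch n) (x : Rn n) : Sch n :=
  SchwartzMap.compCLMOfAntilipschitz (𝕜 := ℝ)
    (Aux.hasTemperateGrowth_sub_left x) (Aux.antilipschitz_sub_left x) ψ

/-- The dilated Schwartz function `ψ(t ·)` (junk value `0` when `t = 0`). -/
def dilate {n : ℕ} (ψ : Sch n) (t : ℝ) : Sch n :=
  if h : t = 0 then 0 else
    SchwartzMap.compCLM (𝕜 := ℝ) (g := fun y : Rn n => t • y)
      (by
        have := (t • ContinuousLinearMap.id ℝ (Rn n)).hasTemperateGrowth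
        exact this)
      (⟨1, |t|⁻¹, fun y => by
        have ht : 0 < |t| := abs_pos.mpr h
        have : ‖t • y‖ = |t| * ‖y‖ := by rw [norm_smul]; simp [Real.norm_eq_abs]
        rw [pow_one, this]
        rw [mul_add, mul_one]
        have : |t|⁻¹ * (|t| * ‖y‖) = ‖y‖ := by field_simp
        nlinarith [norm_nonneg y, inv_pos.mpr ht]⟩) ψ

/-- Fourier transform on Schwartz space. -/
def fourierS {n : ℕ} (φ : Sch n) : Sch n := FourierTransform.fourierCLE ℂ (Sch n) φ

/-- Inverse Fourier transform on Schwartz space. -/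
def invFourierS {n : ℕ} (φ : Sch n) : Sch n := (FourierTransform.fourierCLE ℂ (Sch n)).symm φ

variable {n : ℕ} {E : Type*} [NormedAddCommGroup E] [NormedSpace ℂ E]

/-- Convolution `(ψ * f)(x) := (2π)^{-n/2} f(ψ(x - ·))` of a Schwartz function with an
`E`-valued tempered distribution. -/
def tdConv (ψ : Sch n) (f : TDist n E) : Rn n → E :=
  fun x => ((2 * π) ^ (-(n : ℝ) / 2) : ℝ) • f.toFun (shiftReflect ψ x)

/-- The operator `f ↦ (φ f̂)ˇ = φ̌ * f`. -/
def mOp (φ : Sch n) (f : TDist n E) : Rn n → E := tdConv (invFourierS φ) f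

/-- `L_p`-norm (in `[0,∞]`) of an `ℝ≥0∞`-valued function. -/
def lpNormENN {n : ℕ} (p : ℝ≥0∞) (g : Rn n → ℝ≥0∞) : ℝ≥0∞ :=
  if p = ∞ then essSup g volume else (∫⁻ x, (g x) ^ p.toReal) ^ (1 / p.toReal)

/-- `ℓ_q`-norm (in `[0,∞]`) of a sequence, with the usual modification for `q = ∞`. -/
def lqSum (q : ℝ≥0∞) (a : ℕ → ℝ≥0∞) : ℝ≥0∞ :=
  if q = ∞ then ⨆ j, a j else (∑' j, (a j) ^ q.toReal) ^ (1 / q.toReal)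

/-- A smooth dyadic resolution of unity. -/
structure SmoothResolution (n : ℕ) (φ : ℕ → Sch n) : Prop where
  supp0 : Function.support (φ 0) ⊆ {ξ : Rn n | ‖ξ‖ ≤ 2}
  suppj : ∀ j : ℕ, 0 < j →
    Function.support (φ j) ⊆ {ξ : Rn n | 2 ^ ((j : ℝ) - 1) ≤ ‖ξ‖ ∧ ‖ξ‖ ≤ 2 ^ ((j : ℝ) + 1)}
  sum_eq : ∀ ξ : Rn n, ∑' j : ℕ, φ j ξ = 1
  deriv_bound : ∀ α : Fin n → ℕ, ∃ c : ℝ, ∀ (j : ℕ) (ξ : Rn n),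
    ‖mderiv α (fun y => φ j y) ξ‖ ≤ c * 2 ^ (-(j : ℝ) * (mdeg α : ℝ))

/-- The Besov quasi-norm `‖f | B^s_{p,q}(E)‖` w.r.t. the resolution of unity `φ`. -/
def besovNorm (s : ℝ) (p q : ℝ≥0∞) (φ : ℕ → Sch n) (f : TDist n E) : ℝ≥0∞ :=
  lqSum q fun j => (2 : ℝ≥0∞) ^ ((j : ℝ) * s) * eLpNorm (mOp (φ j) f) p volume

/-- The Triebel–Lizorkin quasi-norm `‖f | F^s_{p,q}(E)‖` w.r.t. the resolution of unity `φ`. -/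
def triebelNorm (s : ℝ) (p q : ℝ≥0∞) (φ : ℕ → Sch n) (f : TDist n E) : ℝ≥0∞ :=
  lpNormENN p fun x =>
    lqSum q fun j => (2 : ℝ≥0∞) ^ ((j : ℝ) * s) * (‖mOp (φ j) f x‖₊ : ℝ≥0∞)

variable {n : ℕ} {E : Type*} [NormedAddCommGroup E] [NormedSpace ℂ E]

/-- Peetre maximal function `sup_y ‖g(x-y)‖/(1+t|y|)^a`. -/
def peetreMax (a t : ℝ) (g : Rn n → E) : Rn n → ℝ≥0∞ :=
  fun x => ⨆ y : Rn n, (‖g (x - y)‖₊ : ℝ≥0∞) / ENNReal.ofReal ((1 + t * ‖y‖) ^ a)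

/-- `‖(Ψ^*f)_a|L_p‖ + (∑_{j≥1} 2^{jsq} ‖(ψ_j^*f)_a|L_p‖^q)^{1/q}`. -/
def besovPeetreNorm (s : ℝ) (p q : ℝ≥0∞) (a : ℝ) (Ψ ψ : Sch n) (f : TDist n E) : ℝ≥0∞ :=
  lpNormENN p (peetreMax a 1 (mOp Ψ f)) +
    lqSum q fun j => (2 : ℝ≥0∞) ^ (((j : ℝ) + 1) * s) *
      lpNormENN p (peetreMax a ((2 : ℝ) ^ ((j : ℝ) + 1))
        (mOp (dilate ψ ((2 : ℝ) ^ (-((j : ℝ) + 1)))) f))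

/-- `‖(Ψ^*f)_a|L_p‖ + ‖(∑_{j≥1} 2^{jsq} ((ψ_j^*f)_a)^q)^{1/q}|L_p‖`. -/
def triebelPeetreNorm (s : ℝ) (p q : ℝ≥0∞) (a : ℝ) (Ψ ψ : Sch n) (f : TDist n E) : ℝ≥0∞ :=
  lpNormENN p (peetreMax a 1 (mOp Ψ f)) +
    lpNormENN p fun x => lqSum q fun j => (2 : ℝ≥0∞) ^ (((j : ℝ) + 1) * s) *
      peetreMax a ((2 : ℝ) ^ ((j : ℝ) + 1))
        (mOp (dilate ψ ((2 : ℝ) ^ (-((j : ℝ) + 1)))) f) x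

namespace BP

open LineDeriv

lemma shiftReflect_apply {n : ℕ} (ψ : Sch n) (x y : Rn n) : shiftReflect ψ x y = ψ (x - y) := rfl

lemma dilate_apply {n : ℕ} (ψ : Sch n) {t : ℝ} (ht : t ≠ 0) (y : Rn n) :
    dilate ψ t y = ψ (t • y) := by
  simp only [dilate, ht, dite_false]
  rfl

/-- product of Schwartz functions -/
def mulS {n : ℕ} (a b : Sch n) : Sch n := SchwartzMap.pairing (ContinuousLinearMap.mul ℂ ℂ) a b

lemma mulS_apply {n : ℕ} (a b : Sch n) (x : Rn n) : mulS a b x = a x * b x := rfl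

/-- iterated directional derivatives along a list -/
def DL {n : ℕ} (l : List (Rn n)) (g : Sch n) : Sch n := l.foldr (fun v h => ∂_{v} h) g

lemma DL_cons {n : ℕ} (v : Rn n) (l : List (Rn n)) (g : Sch n) : DL (v :: l) g = ∂_{v} (DL l g) := rfl

lemma DL_append {n : ℕ} (l l' : List (Rn n)) (g : Sch n) : DL (l ++ l') g = DL l (DL l' g) := by
  simp [DL]

lemma lineDeriv_comm {n : ℕ} (u v : Rn n) (g : Sch n) : ∂_{u} (∂_{v} g) = ∂_{v} (∂_{u} g) := by
  ext x
  have hs : IsSymmSndFDerivAt ℝ g x := by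
    apply (g.smooth 2).contDiffAt.isSymmSndFDerivAt
    simp
  have key : ∀ u v : Rn n, (∂_{u} (∂_{v} g) : Sch n) x = fderiv ℝ (fderiv ℝ g) x u v := by
    intro u v
    rw [SchwartzMap.lineDerivOp_apply_eq_fderiv]
    have : (⇑(∂_{v} g : Sch n)) = fun y => fderiv ℝ g y v := by
      ext y; exact SchwartzMap.lineDerivOp_apply_eq_fderiv v g y
    rw [this, fderiv_clm_apply]
    · simp
    · exact ((g.smooth ⊤).fderiv_right (m := 1) (by norm_cast)).differentiable (by norm_num) x
    · fun_prop
  rw [key, key, hs.eq]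

lemma DL_perm {n : ℕ} {l l' : List (Rn n)} (h : l.Perm l') (g : Sch n) : DL l g = DL l' g := by
  induction h with
  | nil => rfl
  | cons x _ ih => rw [DL_cons, DL_cons, ih]
  | swap x y l => simp only [DL_cons]; exact lineDeriv_comm _ _ _
  | trans _ _ h1 h2 => rw [h1, h2]

/-- the list of directions of a multi-index -/
def ml {n : ℕ} (α : Fin n → ℕ) : List (Rn n) :=
  (List.finRange n).flatMap fun i => List.replicate (α i) (EuclideanSpace.single i (1 : ℝ))

lemma pd_iter {n : ℕ} (i : Fin n) (k : ℕ) (g : Sch n) :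
    (pd i)^[k] (fun y => g y) =
      fun y => DL (List.replicate k (EuclideanSpace.single i (1 : ℝ))) g y := by
  induction k with
  | zero => rfl
  | succ k ih =>
    rw [Function.iterate_succ_apply', ih, List.replicate_succ]
    ext y
    rw [DL_cons, SchwartzMap.lineDerivOp_apply]
    rfl

lemma mderiv_eq {n : ℕ} (α : Fin n → ℕ) (g : Sch n) :
    mderiv α (fun y => g y) = fun y => DL (ml α) g y := by
  unfold mderiv ml
  generalize List.finRange n = L
  induction L with
  | nil => rfl
  | cons i L ih =>
    rw [List.foldr_cons, ih, List.flatMap_cons, DL_append]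
    exact pd_iter i (α i) _

lemma iterated_basis {n k : ℕ} (g : Sch n) (r : Fin k → Fin n) (x : Rn n) :
    iteratedFDeriv ℝ k g x (fun i => EuclideanSpace.single (r i) (1 : ℝ)) =
      DL (List.ofFn fun i => EuclideanSpace.single (r i) (1 : ℝ)) g x := by
  rw [← SchwartzMap.iteratedLineDerivOp_eq_iteratedFDeriv]
  congr 1
  induction k with
  | zero => simp [DL]
  | succ k ih =>
    rw [iteratedLineDerivOp_succ_left, List.ofFn_succ, DL_cons, ← ih]
    rfl

/-- the multi-index of a tuple of directions -/
def cnt {n k : ℕ} (r : Fin k → Fin n) : Fin n → ℕ := fun j => (List.ofFn r).count j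

lemma mdeg_cnt {n k : ℕ} (r : Fin k → Fin n) : mdeg (cnt r) = k := by
  unfold mdeg cnt
  have h2 := Multiset.toFinset_sum_count_eq (↑(List.ofFn r) : Multiset (Fin n))
  simp only [Multiset.coe_count, Multiset.coe_card, List.length_ofFn] at h2
  refine Eq.trans ?_ h2
  symm
  apply Finset.sum_subset (Finset.subset_univ _)
  intro j _ hj
  rw [List.count_eq_zero]
  simpa using hj

lemma ml_perm {n k : ℕ} (r : Fin k → Fin n) :
    (List.ofFn fun i => (EuclideanSpace.single (r i) (1 : ℝ) : Rn n)).Perm (ml (cnt r)) := by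
  have h1 : (List.ofFn fun i => (EuclideanSpace.single (r i) (1 : ℝ) : Rn n)) =
      (List.ofFn r).map (fun j => (EuclideanSpace.single j (1 : ℝ) : Rn n)) := by
    rw [List.map_ofFn]; rfl
  have h2 : ml (cnt r) = ((List.finRange n).flatMap fun i => List.replicate (cnt r i) i).map
      (fun j => (EuclideanSpace.single j (1 : ℝ) : Rn n)) := by
    unfold ml
    rw [List.map_flatMap]
    simp
  rw [h1, h2]
  apply List.Perm.map
  rw [List.perm_iff_count]
  intro j
  rw [List.count_flatMap]
  have : (List.count j ∘ fun i => List.replicate (cnt r i) i) =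
      fun i => if i = j then cnt r j else 0 := by
    ext i
    simp only [Function.comp, List.count_replicate]
    by_cases h : i = j <;> simp [h]
  rw [this, ← List.ofFn_eq_map, List.sum_ofFn]
  simp [cnt]

lemma iterated_le {n : ℕ} (k : ℕ) (g : Sch n) (x : Rn n) :
    ‖iteratedFDeriv ℝ k g x‖ ≤ ∑ r : Fin k → Fin n, ‖mderiv (cnt r) (fun y => g y) x‖ := by
  apply ContinuousMultilinearMap.opNorm_le_bound (by positivity)
  intro m
  have hm : m = fun i => ∑ j, (m i j) • (EuclideanSpace.single j (1 : ℝ) : Rn n) := by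
    ext i j
    simp [Pi.single_apply]
  conv_lhs => rw [hm, ContinuousMultilinearMap.map_sum]
  rw [Finset.sum_mul]
  refine (norm_sum_le _ _).trans (Finset.sum_le_sum fun r _ => ?_)
  rw [ContinuousMultilinearMap.map_smul_univ, norm_smul, iterated_basis, DL_perm (ml_perm r),
    mderiv_eq, mul_comm]
  gcongr
  rw [norm_prod]
  exact Finset.prod_le_prod (fun _ _ => norm_nonneg _) fun i _ => PiLp.norm_apply_le (m i) (r i)

end BP

namespace BP

open LineDeriv

/-- the norm of order `m` on Schwartz space -/
def nrm {n : ℕ} (m : ℕ) (φ : Sch n) : ℝ :=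
  (Finset.Iic (m, m)).sup (schwartzSeminormFamily ℂ (Rn n) ℂ) φ

lemma nrm_nonneg {n : ℕ} (m : ℕ) (φ : Sch n) : 0 ≤ nrm m φ := apply_nonneg _ _

lemma nrm_le {n : ℕ} (m : ℕ) (φ : Sch n) (B : ℝ) (hB : 0 ≤ B)
    (h : ∀ k ≤ m, ∀ i ≤ m, ∀ x, ‖x‖ ^ k * ‖iteratedFDeriv ℝ i φ x‖ ≤ B) : nrm m φ ≤ B := by
  apply Seminorm.finset_sup_apply_le hB
  rintro ⟨k, i⟩ hki
  rw [Finset.mem_Iic, Prod.mk_le_mk] at hki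
  exact SchwartzMap.seminorm_le_bound ℂ k i φ hB (h k hki.1 i hki.2)

lemma le_nrm {n : ℕ} {m k i : ℕ} (hk : k ≤ m) (hi : i ≤ m) (φ : Sch n) (x : Rn n) :
    ‖x‖ ^ k * ‖iteratedFDeriv ℝ i φ x‖ ≤ nrm m φ := by
  refine (SchwartzMap.le_seminorm ℂ k i φ x).trans ?_
  have : (k, i) ∈ Finset.Iic (m, m) := by
    rw [Finset.mem_Iic]; exact Prod.mk_le_mk.2 ⟨hk, hi⟩
  exact Seminorm.le_finset_sup_apply (p := schwartzSeminormFamily ℂ (Rn n) ℂ) this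

lemma le_nrm' {n : ℕ} {m k i : ℕ} (hk : k ≤ m) (hi : i ≤ m) (φ : Sch n) (x : Rn n) :
    (1 + ‖x‖) ^ k * ‖iteratedFDeriv ℝ i φ x‖ ≤ 2 ^ m * nrm m φ :=
  SchwartzMap.one_add_le_sup_seminorm_apply (𝕜 := ℂ) (m := (m, m)) hk hi φ x

lemma seminorm_bd {n : ℕ} (Q : Seminorm ℂ (Sch n)) (hQ : Continuous Q) :
    ∃ (m : ℕ) (C : ℝ), 0 ≤ C ∧ ∀ φ, Q φ ≤ C * nrm m φ := by
  obtain ⟨s, C, _, h⟩ := Seminorm.bound_of_continuous (schwartz_withSeminorms ℂ (Rn n) ℂ) Q hQ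
  refine ⟨s.sup fun p => max p.1 p.2, C, C.2, fun φ => (h φ).trans ?_⟩
  change (C : ℝ) * _ ≤ _
  gcongr
  apply Seminorm.le_def.1
  apply Finset.sup_mono
  intro p hp
  rw [Finset.mem_Iic]
  have := Finset.le_sup (f := fun p : ℕ × ℕ => max p.1 p.2) hp
  exact Prod.mk_le_mk.2 ⟨(le_max_left _ _).trans this, (le_max_right _ _).trans this⟩

lemma clm_bd {n : ℕ} {F : Type*} [NormedAddCommGroup F] [NormedSpace ℂ F] (T : Sch n →L[ℂ] F) :
    ∃ (m : ℕ) (C : ℝ), 0 ≤ C ∧ ∀ φ, ‖T φ‖ ≤ C * nrm m φ :=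
  seminorm_bd ((normSeminorm ℂ F).comp T.toLinearMap) (continuous_norm.comp T.continuous)

lemma clmS_bd {n : ℕ} (T : Sch n →L[ℂ] Sch n) (k : ℕ) :
    ∃ (m : ℕ) (C : ℝ), 0 ≤ C ∧ ∀ φ, nrm k (T φ) ≤ C * nrm m φ :=
  seminorm_bd (((Finset.Iic (k, k)).sup (schwartzSeminormFamily ℂ (Rn n) ℂ)).comp T.toLinearMap) (by
    have h := schwartz_withSeminorms ℂ (Rn n) ℂ
    exact (h.finset_sups.continuous_seminorm (Finset.Iic (k, k))).comp T.continuous)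

/-- `DL` as a continuous linear map -/
def DLc {n : ℕ} (l : List (Rn n)) : Sch n →L[ℂ] Sch n :=
  l.foldr (fun v T => (lineDerivOpCLM ℂ (Sch n) v).comp T) (ContinuousLinearMap.id ℂ _)

lemma DLc_apply {n : ℕ} (l : List (Rn n)) (g : Sch n) : DLc l g = DL l g := by
  induction l with
  | nil => rfl
  | cons v l ih => rw [DL_cons, ← ih]; rfl

/-- the weight -/
def wt {n : ℕ} (K : ℕ) (x : Rn n) : ℂ := (((1 + ‖x‖ ^ 2) ^ ((K : ℝ) / 2) : ℝ) : ℂ)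

lemma wt_temp {n : ℕ} (K : ℕ) : Function.HasTemperateGrowth (wt (n := n) K) := by
  unfold wt
  have := Function.hasTemperateGrowth_one_add_norm_sq_rpow (Rn n) ((K : ℝ) / 2)
  fun_prop

/-- embedding of Schwartz space in a Banach space -/
def J {n : ℕ} (K L : ℕ) : Sch n →L[ℂ] ((Fin n → Fin (L + 1)) → BoundedContinuousFunction (Rn n) ℂ) :=
  ContinuousLinearMap.pi fun α =>
    (SchwartzMap.toBoundedContinuousFunctionCLM ℂ (Rn n) ℂ).comp
      ((SchwartzMap.smulLeftCLM ℂ (wt K)).comp (DLc (ml fun i => (α i : ℕ))))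

lemma J_apply {n : ℕ} (K L : ℕ) (φ : Sch n) (α : Fin n → Fin (L + 1)) (x : Rn n) :
    J K L φ α x = wt K x * DL (ml fun i => (α i : ℕ)) φ x := by
  simp only [J, ContinuousLinearMap.coe_pi', ContinuousLinearMap.comp_apply,
    SchwartzMap.toBoundedContinuousFunctionCLM_apply]
  rw [SchwartzMap.smulLeftCLM_apply_apply (wt_temp K), DLc_apply, smul_eq_mul]

lemma schSemi_le {n : ℕ} (K L : ℕ) (φ : Sch n) :
    schSemi K L φ ≤ (Fintype.card (Fin n → Fin (L + 1)) : ℝ) * ‖J K L φ‖ := by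
  apply ciSup_le
  intro x
  rw [Finset.mul_sum]
  have : ∀ α ∈ (Finset.univ : Finset (Fin n → Fin (L + 1))),
      ((1 + ‖x‖ ^ 2) ^ ((K : ℝ) / 2) * if mdeg (fun i => (α i : ℕ)) ≤ L
      then ‖mderiv (fun i => (α i : ℕ)) (fun y => φ y) x‖ else 0) ≤ ‖J K L φ‖ := by
    intro α _
    split_ifs
    · have h1 : ‖J K L φ α x‖ ≤ ‖J K L φ‖ :=
        (BoundedContinuousFunction.norm_coe_le_norm _ _).trans (norm_le_pi_norm _ _)
      rw [J_apply, norm_mul] at h1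
      rw [mderiv_eq]
      convert h1 using 2
      rw [wt, Complex.norm_real, Real.norm_of_nonneg (by positivity)]
    · simp
  refine (Finset.sum_le_card_nsmul _ _ _ this).trans ?_
  simp

lemma J_inj {n : ℕ} (K L : ℕ) : Function.Injective (J (n := n) K L) := by
  intro a b hab
  ext x
  have := congrArg (fun g => g (fun _ => 0) x) hab
  simp only [J_apply] at this
  have hw : wt K x ≠ 0 := by
    rw [wt]; norm_cast; positivity
  have h2 := mul_left_cancel₀ hw this
  have : ml (fun _ : Fin n => ((0 : Fin (L + 1)) : ℕ)) = [] := by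
    simp [ml]
  rwa [this] at h2

lemma f_bound {n : ℕ} {E : Type*} [NormedAddCommGroup E] [NormedSpace ℂ E] (f : TDist n E) :
    ∃ (K L : ℕ) (C : ℝ), 0 ≤ C ∧ ∀ φ, ‖f.toFun φ‖ ≤ C * ‖J K L φ‖ := by
  obtain ⟨c, K, L, h⟩ := f.bound
  refine ⟨K, L, |c| * (Fintype.card (Fin n → Fin (L + 1)) : ℝ), by positivity, fun φ => ?_⟩
  have h0 : 0 ≤ schSemi K L φ := by
    apply Real.iSup_nonneg
    intro x
    apply mul_nonneg (by positivity)
    apply Finset.sum_nonneg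
    intro α _
    split_ifs <;> positivity
  calc ‖f.toFun φ‖ ≤ c * schSemi K L φ := h φ
    _ ≤ |c| * schSemi K L φ := by gcongr; exact le_abs_self c
    _ ≤ |c| * ((Fintype.card (Fin n → Fin (L + 1)) : ℝ) * ‖J K L φ‖) := by
      gcongr; exact schSemi_le K L φ
    _ = _ := by ring

/-- a tempered distribution as a continuous linear map -/
def fC {n : ℕ} {E : Type*} [NormedAddCommGroup E] [NormedSpace ℂ E] (f : TDist n E) : Sch n →L[ℂ] E :=
  ⟨f.toFun, by
    obtain ⟨K, L, C, hC, h⟩ := f_bound f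
    apply continuous_of_continuousAt_zero f.toFun
    rw [ContinuousAt, map_zero]
    apply squeeze_zero_norm h
    have : Continuous fun φ : Sch n => C * ‖J K L φ‖ := by
      have := (J (n := n) K L).continuous
      fun_prop
    simpa using this.tendsto 0⟩

lemma fC_apply {n : ℕ} {E : Type*} [NormedAddCommGroup E] [NormedSpace ℂ E] (f : TDist n E) (φ : Sch n) :
    fC f φ = f.toFun φ := rfl

/-- the inverse Fourier transform as a CLM -/
def ifC {n : ℕ} : Sch n →L[ℂ] Sch n := (FourierTransform.fourierCLE ℂ (Sch n)).symm

lemma ifC_apply {n : ℕ} (φ : Sch n) : ifC φ = invFourierS φ := rfl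

lemma iterated_shift {n : ℕ} (ψ : Sch n) (x y : Rn n) (i : ℕ) :
    ‖iteratedFDeriv ℝ i (shiftReflect ψ x) y‖ = ‖iteratedFDeriv ℝ i ψ (x - y)‖ := by
  have h1 : ⇑(shiftReflect ψ x) = (fun u => ψ (x + u)) ∘ (LinearIsometryEquiv.neg ℝ : Rn n ≃ₗᵢ[ℝ] Rn n) := by
    ext u; simp [shiftReflect_apply, sub_eq_add_neg]
  rw [h1, LinearIsometryEquiv.norm_iteratedFDeriv_comp_right, iteratedFDeriv_comp_add_left]
  simp [sub_eq_add_neg]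

/-- shiftReflect as CLM -/
def srC {n : ℕ} (x : Rn n) : Sch n →L[ℂ] Sch n :=
  SchwartzMap.compCLMOfAntilipschitz (𝕜 := ℂ)
    (Aux.hasTemperateGrowth_sub_left x) (Aux.antilipschitz_sub_left x)

lemma srC_apply {n : ℕ} (x : Rn n) (ψ : Sch n) : srC x ψ = shiftReflect ψ x := rfl

lemma nrm_shift {n : ℕ} (m : ℕ) (ψ : Sch n) (x : Rn n) :
    nrm m (shiftReflect ψ x) ≤ (2 ^ m * nrm m ψ) * (1 + ‖x‖) ^ m := by
  apply nrm_le _ _ _ (by have := nrm_nonneg m ψ; positivity)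
  intro k hk i hi y
  rw [iterated_shift]
  have h1 : ‖y‖ ≤ (1 + ‖x‖) * (1 + ‖x - y‖) := by
    have : ‖y‖ ≤ ‖x‖ + ‖x - y‖ := by
      have := norm_sub_le x (x - y); simpa using this
    nlinarith [norm_nonneg x, norm_nonneg (x - y)]
  have h2 := le_nrm' hk hi ψ (x - y)
  calc ‖y‖ ^ k * ‖iteratedFDeriv ℝ i ψ (x - y)‖
      ≤ ((1 + ‖x‖) * (1 + ‖x - y‖)) ^ k * ‖iteratedFDeriv ℝ i ψ (x - y)‖ := by gcongr
    _ = (1 + ‖x‖) ^ k * ((1 + ‖x - y‖) ^ k * ‖iteratedFDeriv ℝ i ψ (x - y)‖) := by rw [mul_pow]; ring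
    _ ≤ (1 + ‖x‖) ^ m * (2 ^ m * nrm m ψ) := by
      gcongr
      linarith [norm_nonneg x]
    _ = _ := by ring

end BP

namespace BP

open LineDeriv

lemma shift_diff {n : ℕ} (m : ℕ) (ψ : Sch n) (x x0 : Rn n) (hx : ‖x - x0‖ ≤ 1) :
    nrm m (shiftReflect ψ x - shiftReflect ψ x0) ≤
      (2 ^ (m + 1) * nrm (m + 1) ψ * (2 + ‖x0‖) ^ m) * ‖x - x0‖ := by
  apply nrm_le _ _ _ (by have := nrm_nonneg (m + 1) ψ; positivity)
  intro k hk i hi y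
  have e1 : iteratedFDeriv ℝ i (⇑(shiftReflect ψ x - shiftReflect ψ x0)) y
      = iteratedFDeriv ℝ i (shiftReflect ψ x) y - iteratedFDeriv ℝ i (shiftReflect ψ x0) y := by
    rw [← iteratedFDeriv_sub_apply]
    · rfl
    · exact ((shiftReflect ψ x).smooth i).contDiffAt
    · exact ((shiftReflect ψ x0).smooth i).contDiffAt
  have h1 : ⇑(shiftReflect ψ x - shiftReflect ψ x0) =
      ((fun u => ψ (x + u)) - (fun u => ψ (x0 + u))) ∘ (LinearIsometryEquiv.neg ℝ : Rn n ≃ₗᵢ[ℝ] Rn n) := by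
    ext u; simp [shiftReflect_apply, sub_eq_add_neg]
  rw [h1, LinearIsometryEquiv.norm_iteratedFDeriv_comp_right, iteratedFDeriv_sub_apply,
    iteratedFDeriv_comp_add_left, iteratedFDeriv_comp_add_left]
  rotate_left
  · exact ((ψ.smooth i).comp (by fun_prop)).contDiffAt
  · exact ((ψ.smooth i).comp (by fun_prop)).contDiffAt
  set v : Rn n := (LinearIsometryEquiv.neg ℝ : Rn n ≃ₗᵢ[ℝ] Rn n) y with hv
  have hvy : ‖v‖ = ‖y‖ := by simp [hv]
  have hmv := Convex.norm_image_sub_le_of_norm_fderiv_le (𝕜 := ℝ)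
    (f := fun w => ‖y‖ ^ k • iteratedFDeriv ℝ i ψ (w + v))
    (s := closedBall x0 1) (x := x0) (y := x) (C := 2 ^ (m + 1) * nrm (m + 1) ψ * (2 + ‖x0‖) ^ m)
    (by
      intro w _
      have : ContDiff ℝ 1 (iteratedFDeriv ℝ i ψ) := by
        apply ContDiff.iteratedFDeriv_right (n := i + 1) (ψ.smooth (i + 1 : ℕ))
        norm_cast; omega
      have := this.differentiable (by norm_num)
      fun_prop)
    (by
      intro w hw
      have hd : DifferentiableAt ℝ (iteratedFDeriv ℝ i ψ) (w + v) := by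
        have : ContDiff ℝ 1 (iteratedFDeriv ℝ i ψ) := by
          apply ContDiff.iteratedFDeriv_right (n := i + 1) (ψ.smooth (i + 1 : ℕ))
          norm_cast; omega
        exact this.differentiable (by norm_num) _
      have hc : DifferentiableAt ℝ (fun w => iteratedFDeriv ℝ i ψ (w + v)) w := by
        fun_prop
      rw [fderiv_fun_const_smul hc, fderiv_comp_add_right, norm_smul, norm_fderiv_iteratedFDeriv]
      rw [norm_pow, norm_norm]
      have hw' : ‖w‖ ≤ 1 + ‖x0‖ := by
        rw [mem_closedBall, dist_eq_norm] at hw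
        have := norm_add_le (w - x0) x0
        simp at this; linarith
      have h2 : ‖y‖ ≤ (2 + ‖x0‖) * (1 + ‖w + v‖) := by
        have : ‖v‖ ≤ ‖w‖ + ‖w + v‖ := by
          have := norm_sub_le (w + v) w; simp at this; linarith
        nlinarith [norm_nonneg x0, norm_nonneg (w + v)]
      have h3 := le_nrm' (m := m + 1) (k := k) (i := i + 1) (by omega) (by omega) ψ (w + v)
      calc ‖y‖ ^ k * ‖iteratedFDeriv ℝ (i + 1) ψ (w + v)‖
          ≤ ((2 + ‖x0‖) * (1 + ‖w + v‖)) ^ k * ‖iteratedFDeriv ℝ (i + 1) ψ (w + v)‖ := by gcongr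
        _ = (2 + ‖x0‖) ^ k * ((1 + ‖w + v‖) ^ k * ‖iteratedFDeriv ℝ (i + 1) ψ (w + v)‖) := by
          rw [mul_pow]; ring
        _ ≤ (2 + ‖x0‖) ^ m * (2 ^ (m + 1) * nrm (m + 1) ψ) := by
          gcongr
          linarith [norm_nonneg x0]
        _ = _ := by ring)
    (convex_closedBall _ _) (by simp) (by rw [mem_closedBall, dist_eq_norm]; exact hx)
  rw [← smul_sub, norm_smul, norm_pow, norm_norm] at hmv
  exact hmv

lemma shift_cont {n : ℕ} {F : Type*} [NormedAddCommGroup F] [NormedSpace ℂ F] (T : Sch n →L[ℂ] F)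
    (ψ : Sch n) : Continuous fun x => T (shiftReflect ψ x) := by
  obtain ⟨m, C, hC, h⟩ := clm_bd T
  rw [continuous_iff_continuousAt]
  intro x0
  rw [ContinuousAt, tendsto_iff_norm_sub_tendsto_zero]
  apply squeeze_zero' (g := fun x => C * ((2 ^ (m + 1) * nrm (m + 1) ψ * (2 + ‖x0‖) ^ m) * ‖x - x0‖))
  · exact Eventually.of_forall fun x => norm_nonneg _
  · filter_upwards [closedBall_mem_nhds x0 one_pos] with x hx
    rw [← map_sub]
    refine (h _).trans ?_
    gcongr
    exact shift_diff m ψ x x0 (by rwa [mem_closedBall, dist_eq_norm] at hx)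
  · have : Continuous fun x => C * ((2 ^ (m + 1) * nrm (m + 1) ψ * (2 + ‖x0‖) ^ m) * ‖x - x0‖) := by
      fun_prop
    simpa using this.tendsto x0

lemma shift_growth {n : ℕ} {F : Type*} [NormedAddCommGroup F] [NormedSpace ℂ F] (T : Sch n →L[ℂ] F) :
    ∃ m : ℕ, ∀ ψ : Sch n, ∃ C : ℝ, 0 ≤ C ∧ ∀ x, ‖T (shiftReflect ψ x)‖ ≤ C * (1 + ‖x‖) ^ m := by
  obtain ⟨m, C, hC, h⟩ := clm_bd T
  refine ⟨m, fun ψ => ⟨C * (2 ^ m * nrm m ψ), by have := nrm_nonneg m ψ; positivity, fun x => ?_⟩⟩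
  refine (h _).trans ?_
  rw [mul_assoc]
  gcongr
  exact nrm_shift m ψ x

lemma mOp_eq {n : ℕ} {E : Type*} [NormedAddCommGroup E] [NormedSpace ℂ E] (χ : Sch n) (f : TDist n E)
    (x : Rn n) : mOp χ f x = ((2 * π) ^ (-(n : ℝ) / 2) : ℝ) • fC f (shiftReflect (ifC χ) x) := rfl

lemma mOp_cont {n : ℕ} {E : Type*} [NormedAddCommGroup E] [NormedSpace ℂ E] (χ : Sch n) (f : TDist n E) :
    Continuous (mOp χ f) := (shift_cont (fC f) _).const_smul _

lemma mOp_growth {n : ℕ} {E : Type*} [NormedAddCommGroup E] [NormedSpace ℂ E] (f : TDist n E) :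
    ∃ m : ℕ, ∀ χ : Sch n, ∃ C : ℝ, 0 ≤ C ∧ ∀ x, ‖mOp χ f x‖ ≤ C * (1 + ‖x‖) ^ m := by
  obtain ⟨m, h⟩ := shift_growth (fC f)
  refine ⟨m, fun χ => ?_⟩
  obtain ⟨C, hC, h⟩ := h (ifC χ)
  refine ⟨(2 * π) ^ (-(n : ℝ) / 2) * C, by positivity, fun x => ?_⟩
  rw [mOp_eq, norm_smul, Real.norm_of_nonneg (by positivity), mul_assoc]
  gcongr
  exact h x

/-- `mOp` at a point, as a linear map in the multiplier -/
def mOpL {n : ℕ} {E : Type*} [NormedAddCommGroup E] [NormedSpace ℂ E] (f : TDist n E) (x : Rn n) :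
    Sch n →L[ℂ] E := ((2 * π) ^ (-(n : ℝ) / 2) : ℝ) • ((fC f).comp ((srC x).comp ifC))

lemma mOpL_apply {n : ℕ} {E : Type*} [NormedAddCommGroup E] [NormedSpace ℂ E] (f : TDist n E) (x : Rn n)
    (χ : Sch n) : mOpL f x χ = mOp χ f x := rfl

lemma conv_deriv {n : ℕ} (f g : Sch n) (v : Rn n) :
    ∂_{v} (SchwartzMap.convolution (ContinuousLinearMap.mul ℂ ℂ) f g) =
      SchwartzMap.convolution (ContinuousLinearMap.mul ℂ ℂ) f (∂_{v} g) := by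
  apply (FourierTransform.fourierCLE ℂ (Sch n)).injective
  rw [FourierTransform.fourierCLE_apply, FourierTransform.fourierCLE_apply]
  rw [SchwartzMap.fourier_lineDerivOp_eq, fourier_convolution, fourier_convolution,
    SchwartzMap.fourier_lineDerivOp_eq]
  ext x
  have ht : Function.HasTemperateGrowth (fun x : Rn n => inner ℝ x v) := by fun_prop
  simp only [_root_.smul_apply, SchwartzMap.pairing_apply_apply, SchwartzMap.smulLeftCLM_apply_apply ht,
    ContinuousLinearMap.mul_apply']
  simp
  ring

lemma conv_DL {n : ℕ} (f g : Sch n) (l : List (Rn n)) :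
    DL l (SchwartzMap.convolution (ContinuousLinearMap.mul ℂ ℂ) f g) =
      SchwartzMap.convolution (ContinuousLinearMap.mul ℂ ℂ) f (DL l g) := by
  induction l with
  | nil => rfl
  | cons v l ih => rw [DL_cons, ih, conv_deriv]; rfl

lemma shift_DL {n : ℕ} (g : Sch n) (x : Rn n) (l : List (Rn n)) :
    DL l (shiftReflect g x) = (-1 : ℂ) ^ l.length • shiftReflect (DL l g) x := by
  induction l with
  | nil => simp [DL]
  | cons v l ih =>
    rw [DL_cons, ih, DL_cons]
    ext y
    rw [SchwartzMap.lineDerivOp_apply_eq_fderiv]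
    have hd : DifferentiableAt ℝ (fun y => (DL l g) (x - y)) y := by
      have := (DL l g).differentiable
      fun_prop
    have : ⇑((-1 : ℂ) ^ l.length • shiftReflect (DL l g) x) =
        fun y => (-1 : ℂ) ^ l.length • (DL l g) (x - y) := by
      ext y; rfl
    rw [this, fderiv_fun_const_smul hd]
    have h4 : HasFDerivAt (fun y => (DL l g) (x - y)) ((fderiv ℝ (DL l g) (x - y)).comp (-(ContinuousLinearMap.id ℝ (Rn n)))) y :=
      ((DL l g).differentiable (x - y)).hasFDerivAt.comp y ((hasFDerivAt_id y).const_sub x)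
    rw [h4.fderiv]
    simp [SchwartzMap.lineDerivOp_apply_eq_fderiv, shiftReflect_apply, pow_succ]

lemma shift_int {n : ℕ} {F : Type*} [NormedAddCommGroup F] [NormedSpace ℂ F] (T : Sch n →L[ℂ] F)
    (f g : Sch n) (x : Rn n) : Integrable (fun z => f z • T (shiftReflect g (x - z))) := by
    have hcont : Continuous fun z => T (shiftReflect g (x - z)) :=
      (shift_cont T g).comp (by fun_prop)
    obtain ⟨m, h⟩ := shift_growth T
    obtain ⟨C, hC, h⟩ := h g
    have h1 : Integrable (fun z => (C * (1 + ‖x‖) ^ m) * ((1 + ‖z‖) ^ m * ‖f z‖)) := by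
      apply Integrable.const_mul
      have h2 := (f.integrable_pow_mul volume m)
      have h3 := (f.integrable_pow_mul volume 0)
      simp only [pow_zero, one_mul] at h3
      refine ((h3.add h2).const_mul (2 ^ m)).mono' ?_ ?_
      · have := f.continuous
        exact Continuous.aestronglyMeasurable (by fun_prop)
      · refine Eventually.of_forall fun z => ?_
        rw [Real.norm_of_nonneg (by positivity)]
        have : (1 + ‖z‖) ^ m ≤ 2 ^ m * (1 + ‖z‖ ^ m) := by
          have h := add_pow_le (zero_le_one (α := ℝ)) (norm_nonneg z) m
          rw [one_pow] at h
          refine h.trans ?_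
          gcongr
          · norm_num
          · omega
        calc (1 + ‖z‖) ^ m * ‖f z‖ ≤ 2 ^ m * (1 + ‖z‖ ^ m) * ‖f z‖ := by gcongr
          _ = _ := by simp [Pi.add_apply]; ring
    refine h1.mono' ((f.continuous.smul hcont).aestronglyMeasurable) (Eventually.of_forall fun z => ?_)
    rw [norm_smul]
    calc ‖f z‖ * ‖T (shiftReflect g (x - z))‖ ≤ ‖f z‖ * (C * (1 + ‖x - z‖) ^ m) := by
          gcongr; exact h _
      _ ≤ ‖f z‖ * (C * ((1 + ‖x‖) * (1 + ‖z‖)) ^ m) := by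
          gcongr
          nlinarith [norm_sub_le x z, norm_nonneg x, norm_nonneg z]
      _ = _ := by rw [mul_pow]; ring

lemma J_conv {n : ℕ} (K L : ℕ) (f g : Sch n) (x : Rn n) :
    J K L (shiftReflect (SchwartzMap.convolution (ContinuousLinearMap.mul ℂ ℂ) f g) x) =
      ∫ z, f z • J K L (shiftReflect g (x - z)) := by
  have hint := shift_int (J K L) f g x
  ext α y
  let ev : ((Fin n → Fin (L + 1)) → BoundedContinuousFunction (Rn n) ℂ) →L[ℂ] ℂ :=
    (BoundedContinuousFunction.evalCLM ℂ y).comp (ContinuousLinearMap.proj α)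
  have h1 := ev.integral_comp_comm hint
  have h2 : ∀ u, ev u = u α y := fun u => rfl
  rw [h2] at h1
  rw [← h1]
  have h3 : ∀ (c : ℂ) u, ev (c • u) = c * u α y := fun c u => by rw [map_smul, h2, smul_eq_mul]
  simp only [h3, J_apply, shift_DL, conv_DL]
  rw [_root_.smul_apply, shiftReflect_apply, SchwartzMap.convolution_apply]
  simp only [MeasureTheory.convolution, ContinuousLinearMap.mul_apply', smul_eq_mul]
  rw [← integral_const_mul, ← integral_const_mul]
  congr 1; ext z
  rw [show x - y - z = x - z - y by abel, _root_.smul_apply, shiftReflect_apply, smul_eq_mul]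
  ring

lemma f_conv {n : ℕ} {E : Type*} [NormedAddCommGroup E] [NormedSpace ℂ E] (F : TDist n E)
    (f g : Sch n) (x : Rn n) [CompleteSpace E] :
    fC F (shiftReflect (SchwartzMap.convolution (ContinuousLinearMap.mul ℂ ℂ) f g) x) =
      ∫ z, f z • fC F (shiftReflect g (x - z)) := by
  obtain ⟨K, L, C, hC, hb⟩ := f_bound F
  rw [SeparatingDual.eq_iff_forall_dual_eq (R := ℂ)]
  intro e
  let R := (J (n := n) K L).toLinearMap.range
  let eq : Sch n ≃ₗ[ℂ] R := LinearEquiv.ofInjective (J (n := n) K L).toLinearMap (J_inj K L)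
  have heq : ∀ φ, ((eq φ : R) : (Fin n → Fin (L + 1)) → BoundedContinuousFunction (Rn n) ℂ) = J K L φ :=
    fun φ => rfl
  let l0 : R →ₗ[ℂ] ℂ := (e.toLinearMap ∘ₗ F.toFun) ∘ₗ eq.symm.toLinearMap
  let l1 : R →L[ℂ] ℂ := l0.mkContinuous (‖e‖ * C) (by
    intro r
    obtain ⟨φ, rfl⟩ := eq.surjective r
    have : l0 (eq φ) = e (F.toFun φ) := by simp [l0]
    rw [this]
    refine (e.le_opNorm _).trans ?_
    rw [mul_assoc]
    gcongr
    exact hb φ)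
  obtain ⟨G, hG, -⟩ := exists_extension_norm_eq R l1
  have hG' : ∀ φ, G (J K L φ) = e (fC F φ) := by
    intro φ
    rw [← heq, hG]
    simp [l1, l0, fC_apply]
  rw [← hG', J_conv, ← ContinuousLinearMap.integral_comp_comm _ (shift_int _ f g x),
    ← ContinuousLinearMap.integral_comp_comm _ (shift_int _ f g x)]
  simp only [map_smul, hG']

lemma mOp_mul {n : ℕ} {E : Type*} [NormedAddCommGroup E] [NormedSpace ℂ E] [CompleteSpace E]
    (F : TDist n E) (a b : Sch n) (x : Rn n) :
    mOp (mulS a b) F x = ∫ z, ifC a z • mOp b F (x - z) := by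
  have h : ifC (mulS a b) =
      SchwartzMap.convolution (ContinuousLinearMap.mul ℂ ℂ) (ifC a) (ifC b) := by
    apply (FourierTransform.fourierCLE ℂ (Sch n)).injective
    rw [FourierTransform.fourierCLE_apply, FourierTransform.fourierCLE_apply, fourier_convolution]
    have : ∀ c : Sch n, 𝓕 (ifC c) = c := fun c => (FourierTransform.fourierCLE ℂ (Sch n)).apply_symm_apply c
    rw [this, this, this]
    rfl
  simp only [mOp_eq]
  rw [h, f_conv, ← integral_smul]
  congr 1; ext z
  rw [smul_comm]

end BP

namespace BP

/-- the basic kernel -/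
def kern {n : ℕ} (r t : ℝ) (z : Rn n) : ℝ≥0∞ := ENNReal.ofReal (t ^ n * (1 + t * ‖z‖) ^ (-r))

/-- its integral -/
def II (n : ℕ) (r : ℝ) : ℝ≥0∞ := ∫⁻ z : Rn n, ENNReal.ofReal ((1 + ‖z‖) ^ (-r))

lemma II_lt {n : ℕ} {r : ℝ} (hr : (n : ℝ) < r) : II n r < ∞ := by
  apply finite_integral_one_add_norm
  simpa using hr

lemma kern_meas {n : ℕ} (r t : ℝ) : Measurable (kern (n := n) r t) := by
  unfold kern; fun_prop

lemma kern_int {n : ℕ} (r : ℝ) {t : ℝ} (ht : 0 < t) : ∫⁻ z : Rn n, kern r t z = II n r := by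
  have hm : Measurable fun z : Rn n => ENNReal.ofReal ((1 + ‖z‖) ^ (-r)) := by fun_prop
  have h1 : ∫⁻ z : Rn n, ENNReal.ofReal ((1 + ‖t • z‖) ^ (-r)) =
      ENNReal.ofReal (abs (t ^ Module.finrank ℝ (Rn n))⁻¹) * II n r := by
    have h2 := Measure.map_addHaar_smul (volume : Measure (Rn n)) ht.ne'
    have h3 := lintegral_map (μ := (volume : Measure (Rn n))) hm (g := fun z => t • z) (by fun_prop)
    rw [← h3, h2, lintegral_smul_measure]; rfl
  have h2 : ∀ z : Rn n, kern r t z = ENNReal.ofReal (t ^ n) * ENNReal.ofReal ((1 + ‖t • z‖) ^ (-r)) := by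
    intro z
    rw [kern, norm_smul, Real.norm_of_nonneg ht.le, ENNReal.ofReal_mul (by positivity)]
  simp_rw [h2]
  rw [lintegral_const_mul _ (by fun_prop), h1, ← mul_assoc, ← ENNReal.ofReal_mul (by positivity)]
  simp only [finrank_euclideanSpace, Fintype.card_fin]
  rw [abs_of_pos (by positivity), mul_inv_cancel₀ (by positivity)]
  simp

lemma ifC_dilate {n : ℕ} (M : Sch n) {t : ℝ} (ht : 0 < t) (z : Rn n) :
    ifC (dilate M t⁻¹) z = (t ^ n : ℝ) • ifC M (t • z) := by
  have h : ∀ (M : Sch n) (z : Rn n), ifC M z = ∫ v, Real.fourierChar (inner ℝ v z) • M v := by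
    intro M z
    have h1 : ifC M z = (𝓕⁻ M : Sch n) z := rfl
    rw [h1, SchwartzMap.fourierInv_coe, Real.fourierInv_eq]
  rw [h, h]
  have h2 := Measure.integral_comp_inv_smul_of_nonneg (volume : Measure (Rn n))
    (fun v => Real.fourierChar (inner ℝ v (t • z)) • M v) ht.le
  rw [finrank_euclideanSpace, Fintype.card_fin] at h2
  rw [← h2]
  congr 1; ext v
  rw [dilate_apply _ (inv_ne_zero ht.ne'), real_inner_smul_left, real_inner_smul_right,
    inv_mul_cancel_left₀ ht.ne']

lemma kernel_bd {n : ℕ} (r : ℝ) : ∃ (m : ℕ) (C : ℝ), 0 ≤ C ∧ ∀ (M : Sch n) (t : ℝ), 0 < t → ∀ z,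
    ‖ifC (dilate M t⁻¹) z‖ₑ ≤ ENNReal.ofReal (C * nrm m M) * kern r t z := by
  obtain ⟨N, hN⟩ := exists_nat_ge r
  obtain ⟨m, C, hC, h⟩ := clmS_bd (n := n) ifC N
  refine ⟨m, 2 ^ N * C, by positivity, fun M t ht z => ?_⟩
  have hn := nrm_nonneg m M
  rw [kern, ← ENNReal.ofReal_mul (by positivity), ← ofReal_norm]
  apply ENNReal.ofReal_le_ofReal
  rw [ifC_dilate M ht, norm_smul, Real.norm_of_nonneg (by positivity)]
  have h1 := le_nrm' (m := N) (k := N) (i := 0) le_rfl (by omega) (ifC M) (t • z)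
  rw [norm_iteratedFDeriv_zero, norm_smul, Real.norm_of_nonneg ht.le] at h1
  have h2 : (1 + t * ‖z‖) ^ r ≤ (1 + t * ‖z‖) ^ N := by
    rw [← Real.rpow_natCast]
    apply Real.rpow_le_rpow_of_exponent_le _ hN
    have : 0 ≤ t * ‖z‖ := by positivity
    linarith
  have h3 : (1 + t * ‖z‖) ^ r * ‖ifC M (t • z)‖ ≤ 2 ^ N * C * nrm m M := by
    calc _ ≤ (1 + t * ‖z‖) ^ N * ‖ifC M (t • z)‖ := by gcongr
      _ ≤ 2 ^ N * nrm N (ifC M) := h1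
      _ ≤ 2 ^ N * (C * nrm m M) := by gcongr; exact h M
      _ = _ := by ring
  have hpos : 0 < 1 + t * ‖z‖ := by positivity
  have h4 : ‖ifC M (t • z)‖ ≤ 2 ^ N * C * nrm m M * (1 + t * ‖z‖) ^ (-r) := by
    rw [Real.rpow_neg hpos.le, ← div_eq_mul_inv, le_div_iff₀ (by positivity), mul_comm]
    exact h3
  calc t ^ n * ‖ifC M (t • z)‖ ≤ t ^ n * (2 ^ N * C * nrm m M * (1 + t * ‖z‖) ^ (-r)) := by gcongr
    _ = _ := by ring

lemma V_bd {n : ℕ} (r : ℝ) : ∃ (m : ℕ) (C : ℝ), 0 ≤ C ∧ ∀ (E : Type*) [NormedAddCommGroup E]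
    [NormedSpace ℂ E] [CompleteSpace E] (M χ : Sch n) (f : TDist n E) (t : ℝ), 0 < t → ∀ x,
    ‖mOp (mulS (dilate M t⁻¹) χ) f x‖ₑ ≤
      ENNReal.ofReal (C * nrm m M) * ∫⁻ z, kern r t z * ‖mOp χ f (x - z)‖ₑ := by
  obtain ⟨m, C, hC, h⟩ := kernel_bd (n := n) r
  refine ⟨m, C, hC, ?_⟩
  intro E _ _ _ M χ f t ht x
  rw [mOp_mul]
  refine (enorm_integral_le_lintegral_enorm _).trans ?_
  have hc := mOp_cont χ f
  rw [← lintegral_const_mul _ (by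
    apply (kern_meas r t).mul
    exact (Continuous.enorm (by fun_prop)).measurable)]
  apply lintegral_mono
  intro z
  simp only [enorm_smul]
  rw [← mul_assoc]
  gcongr
  exact h M t ht z

/-- Peetre weight bound -/
lemma le_peetre {n : ℕ} {E : Type*} [NormedAddCommGroup E] [NormedSpace ℂ E] (a : ℝ) {t : ℝ} (ht : 0 ≤ t)
    (g : Rn n → E) (x y : Rn n) :
    ‖g (x - y)‖ₑ ≤ peetreMax a t g x * ENNReal.ofReal ((1 + t * ‖y‖) ^ a) := by
  have hpos : 0 < (1 + t * ‖y‖) ^ a := by positivity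
  rw [← ENNReal.div_le_iff (by simpa using hpos) ENNReal.ofReal_ne_top]
  exact le_iSup (fun y => (‖g (x - y)‖₊ : ℝ≥0∞) / ENNReal.ofReal ((1 + t * ‖y‖) ^ a)) y

lemma peetre_le {n : ℕ} {E : Type*} [NormedAddCommGroup E] [NormedSpace ℂ E] (a : ℝ) {t : ℝ} (ht : 0 ≤ t)
    (g : Rn n → E) (x : Rn n) (B : ℝ≥0∞)
    (h : ∀ y, ‖g (x - y)‖ₑ ≤ B * ENNReal.ofReal ((1 + t * ‖y‖) ^ a)) : peetreMax a t g x ≤ B := by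
  apply iSup_le
  intro y
  have hpos : 0 < (1 + t * ‖y‖) ^ a := by positivity
  rw [ENNReal.div_le_iff (by simpa using hpos) ENNReal.ofReal_ne_top]
  exact h y

lemma le_peetre0 {n : ℕ} {E : Type*} [NormedAddCommGroup E] [NormedSpace ℂ E] (a : ℝ) {t : ℝ} (ht : 0 ≤ t)
    (g : Rn n → E) (x : Rn n) : ‖g x‖ₑ ≤ peetreMax a t g x := by
  simpa using le_peetre a ht g x 0

lemma peetre_scale {n : ℕ} {E : Type*} [NormedAddCommGroup E] [NormedSpace ℂ E] {a : ℝ} (ha : 0 ≤ a)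
    {t t' c : ℝ} (ht : 0 ≤ t) (ht' : 0 ≤ t') (hc : 1 ≤ c) (h : t' ≤ c * t) (g : Rn n → E) (x : Rn n) :
    peetreMax a t g x ≤ ENNReal.ofReal (c ^ a) * peetreMax a t' g x := by
  apply peetre_le a ht
  intro y
  refine (le_peetre a ht' g x y).trans ?_
  rw [mul_comm (ENNReal.ofReal (c ^ a)), mul_assoc, ← ENNReal.ofReal_mul (by positivity),
    ← Real.mul_rpow (by positivity) (by positivity)]
  gcongr
  nlinarith [mul_le_mul_of_nonneg_right h (norm_nonneg y)]

lemma wt_sub {n : ℕ} {a : ℝ} (ha : 0 ≤ a) {t : ℝ} (ht : 0 ≤ t) (y z : Rn n) :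
    (1 + t * ‖y + z‖) ^ a ≤ (1 + t * ‖y‖) ^ a * (1 + t * ‖z‖) ^ a := by
  rw [← Real.mul_rpow (by positivity) (by positivity)]
  gcongr
  have h1 : t * ‖y + z‖ ≤ t * ‖y‖ + t * ‖z‖ := by
    rw [← mul_add]; gcongr; exact norm_add_le y z
  have h2 : 0 ≤ t * ‖y‖ * (t * ‖z‖) := by positivity
  nlinarith

lemma W_bd {n : ℕ} {a : ℝ} (ha : 0 ≤ a) : ∃ (m : ℕ) (C : ℝ), 0 ≤ C ∧ ∀ (E : Type*) [NormedAddCommGroup E]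
    [NormedSpace ℂ E] [CompleteSpace E] (M χ : Sch n) (f : TDist n E) (t : ℝ), 0 < t → ∀ x y,
    ‖mOp (mulS (dilate M t⁻¹) χ) f (x - y)‖ₑ ≤
      ENNReal.ofReal (C * nrm m M * (1 + t * ‖y‖) ^ a) * peetreMax a t (mOp χ f) x := by
  obtain ⟨m, C, hC, h⟩ := V_bd (n := n) (a + (n + 1))
  have hI : II n (n + 1) < ∞ := II_lt (by linarith)
  refine ⟨m, C * (II n (n + 1)).toReal, by positivity, ?_⟩
  intro E _ _ _ M χ f t ht x y
  have hn := nrm_nonneg m M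
  refine (h E M χ f t ht (x - y)).trans ?_
  have key : ∀ z, kern (a + (n + 1)) t z * ‖mOp χ f (x - y - z)‖ₑ ≤
      (ENNReal.ofReal ((1 + t * ‖y‖) ^ a) * peetreMax a t (mOp χ f) x) * kern (n + 1) t z := by
    intro z
    have h1 := le_peetre a ht.le (mOp χ f) x (y + z)
    rw [← sub_sub] at h1
    have hpos : 0 < 1 + t * ‖z‖ := by positivity
    calc kern (a + (n + 1)) t z * ‖mOp χ f (x - y - z)‖ₑ
        ≤ kern (a + (n + 1)) t z * (peetreMax a t (mOp χ f) x *
          ENNReal.ofReal ((1 + t * ‖y‖) ^ a * (1 + t * ‖z‖) ^ a)) := by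
          gcongr
          refine h1.trans ?_
          gcongr
          exact wt_sub ha ht.le y z
      _ = (ENNReal.ofReal ((1 + t * ‖y‖) ^ a) * peetreMax a t (mOp χ f) x) *
          (kern (a + (n + 1)) t z * ENNReal.ofReal ((1 + t * ‖z‖) ^ a)) := by
          rw [ENNReal.ofReal_mul (by positivity)]; ring
      _ = _ := by
          congr 1
          rw [kern, kern, ← ENNReal.ofReal_mul (by positivity), mul_assoc, ← Real.rpow_add hpos]
          congr 3; ring
  refine (mul_le_mul_right (lintegral_mono key) _).trans ?_
  rw [lintegral_const_mul _ (kern_meas _ _), kern_int _ ht]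
  rw [show C * (II n (n + 1)).toReal * nrm m M * (1 + t * ‖y‖) ^ a =
    (C * nrm m M) * ((1 + t * ‖y‖) ^ a * (II n (n + 1)).toReal) by ring]
  rw [ENNReal.ofReal_mul (p := C * nrm m M) (by positivity), ENNReal.ofReal_mul (p := (1 + t * ‖y‖) ^ a) (by positivity), ENNReal.ofReal_toReal hI.ne]
  apply le_of_eq; ring

end BP

namespace BP

lemma jensen {n : ℕ} (k h : Rn n → ℝ≥0∞) (hk : Measurable k) (hh : Measurable h) {p : ℝ} (hp : 1 < p) :
    (∫⁻ x, k x * h x) ^ p ≤ (∫⁻ x, k x) ^ (p - 1) * ∫⁻ x, k x * h x ^ p := by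
  have hpq := Real.HolderConjugate.conjExponent hp
  set q := Real.conjExponent p
  have h1 := ENNReal.lintegral_mul_le_Lp_mul_Lq volume hpq.symm (f := fun x => k x ^ (1 / q))
    (g := fun x => k x ^ (1 / p) * h x) (by fun_prop) (by fun_prop)
  have hq0 : 0 < q := hpq.symm.pos
  have hp0 : 0 < p := by linarith
  have e1 : ∀ x, (k x ^ (1 / q)) ^ q = k x := by
    intro x; rw [← ENNReal.rpow_mul, one_div, inv_mul_cancel₀ hq0.ne', ENNReal.rpow_one]
  have e2 : ∀ x, (k x ^ (1 / p) * h x) ^ p = k x * h x ^ p := by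
    intro x
    rw [ENNReal.mul_rpow_of_nonneg _ _ hp0.le, ← ENNReal.rpow_mul, one_div, inv_mul_cancel₀ hp0.ne',
      ENNReal.rpow_one]
  have e3 : ∀ x, ((fun x => k x ^ (1 / q)) * fun x => k x ^ (1 / p) * h x) x = k x * h x := by
    intro x
    simp only [Pi.mul_apply]
    rw [← mul_assoc, ← ENNReal.rpow_add_of_nonneg _ _ (by positivity) (by positivity)]
    have : 1 / q + 1 / p = 1 := by
      have := hpq.inv_add_inv_eq_one
      rw [one_div, one_div]; linarith
    rw [this, ENNReal.rpow_one]
  simp only [e1, e2, e3] at h1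
  calc (∫⁻ x, k x * h x) ^ p ≤ ((∫⁻ x, k x) ^ (1 / q) * (∫⁻ x, k x * h x ^ p) ^ (1 / p)) ^ p := by gcongr
    _ = _ := by
      rw [ENNReal.mul_rpow_of_nonneg _ _ hp0.le, ← ENNReal.rpow_mul, ← ENNReal.rpow_mul]
      have : 1 / q * p = p - 1 := by
        have := hpq.inv_add_inv_eq_one
        field_simp at this ⊢
        nlinarith
      rw [this, one_div, inv_mul_cancel₀ hp0.ne', ENNReal.rpow_one]

lemma kern_shift {n : ℕ} {r b t : ℝ} (hb : 0 ≤ b) (hbr : b ≤ r) (ht : 0 < t) (w y : Rn n) :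
    kern r t (w - y) ≤ ENNReal.ofReal ((1 + t * ‖y‖) ^ b) * kern b t w := by
  rw [kern, kern, ← ENNReal.ofReal_mul (by positivity)]
  apply ENNReal.ofReal_le_ofReal
  have h1 : (1 + t * ‖w - y‖) ^ (-r) ≤ (1 + t * ‖w - y‖) ^ (-b) := by
    apply Real.rpow_le_rpow_of_exponent_le _ (by linarith)
    have : 0 ≤ t * ‖w - y‖ := by positivity
    linarith
  have h2 := wt_sub hb ht.le (w - y) y
  rw [sub_add_cancel] at h2
  have h3 : (1 + t * ‖w - y‖) ^ (-b) ≤ (1 + t * ‖y‖) ^ b * (1 + t * ‖w‖) ^ (-b) := by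
    rw [Real.rpow_neg (by positivity), Real.rpow_neg (by positivity), ← div_eq_mul_inv,
      inv_eq_one_div, div_le_div_iff₀ (by positivity) (by positivity)]
    linarith
  calc t ^ n * (1 + t * ‖w - y‖) ^ (-r) ≤ t ^ n * ((1 + t * ‖y‖) ^ b * (1 + t * ‖w‖) ^ (-b)) := by
        gcongr; exact h1.trans h3
    _ = _ := by ring

lemma lint_shift {n : ℕ} (k h : Rn n → ℝ≥0∞) (x y : Rn n) :
    ∫⁻ z, k z * h (x - y - z) = ∫⁻ w, k (w - y) * h (x - w) := by
  rw [← lintegral_sub_right_eq_self (μ := volume) (fun z => k z * h (x - y - z)) y]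
  congr 1; ext w
  congr 2; abel

/-- the `p`-mean -/
def GG {n : ℕ} {E : Type*} [NormedAddCommGroup E] (p b t : ℝ) (g : Rn n → E) (x : Rn n) : ℝ≥0∞ :=
  ∫⁻ w, kern (b * p) t w * ‖g (x - w)‖ₑ ^ p

lemma peetre_small {n : ℕ} {E : Type*} [NormedAddCommGroup E] [NormedSpace ℂ E] {p b t : ℝ} (hp : 0 < p)
    (hp1 : p ≤ 1) (hb : 0 ≤ b) (ht : 0 < t) (g : Rn n → E) (hg : Continuous g) (A : ℝ≥0∞)
    (hA : ∀ x, ‖g x‖ₑ ≤ A * ∫⁻ z, kern b t z * ‖g (x - z)‖ₑ) (x : Rn n)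
    (hfin : peetreMax b t g x ≠ ∞) : peetreMax b t g x ^ p ≤ A * GG p b t g x := by
  set P := peetreMax b t g x with hP
  by_cases hP0 : P = 0
  · rw [hP0, ENNReal.zero_rpow_of_pos hp]; exact zero_le
  have h1 : P ≤ A * (P ^ (1 - p) * GG p b t g x) := by
    apply peetre_le b ht.le
    intro y
    refine (hA _).trans ?_
    rw [lint_shift (kern b t) (fun u => ‖g u‖ₑ), mul_assoc]
    gcongr
    have hm : Measurable fun w => kern (b * p) t w * ‖g (x - w)‖ₑ ^ p := by
      have := kern_meas (n := n) (b * p) t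
      have h2 : Measurable fun w => ‖g (x - w)‖ₑ := (Continuous.enorm (by fun_prop)).measurable
      fun_prop
    rw [GG, mul_comm, ← mul_assoc, ← lintegral_const_mul _ hm]
    apply lintegral_mono
    intro w
    have e1 : ‖g (x - w)‖ₑ = ‖g (x - w)‖ₑ ^ (1 - p) * ‖g (x - w)‖ₑ ^ p := by
      rw [← ENNReal.rpow_add_of_nonneg _ _ (by linarith) hp.le]
      simp
    have e2 : ‖g (x - w)‖ₑ ^ (1 - p) ≤ P ^ (1 - p) * ENNReal.ofReal ((1 + t * ‖w‖) ^ (b * (1 - p))) := by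
      have := le_peetre b ht.le g x w
      calc _ ≤ (P * ENNReal.ofReal ((1 + t * ‖w‖) ^ b)) ^ (1 - p) :=
            ENNReal.rpow_le_rpow this (by linarith)
        _ = _ := by
          rw [ENNReal.mul_rpow_of_nonneg _ _ (by linarith), ENNReal.ofReal_rpow_of_nonneg (by positivity) (by linarith),
            ← Real.rpow_mul (by positivity)]
    have e3 : kern b t w * ENNReal.ofReal ((1 + t * ‖w‖) ^ (b * (1 - p))) = kern (b * p) t w := by
      rw [kern, kern, ← ENNReal.ofReal_mul (by positivity), mul_assoc, ← Real.rpow_add (by positivity)]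
      congr 3; ring
    calc kern b t (w - y) * ‖g (x - w)‖ₑ
        = kern b t (w - y) * (‖g (x - w)‖ₑ ^ (1 - p) * ‖g (x - w)‖ₑ ^ p) := by rw [← e1]
      _ ≤ (ENNReal.ofReal ((1 + t * ‖y‖) ^ b) * kern b t w) *
          ((P ^ (1 - p) * ENNReal.ofReal ((1 + t * ‖w‖) ^ (b * (1 - p)))) * ‖g (x - w)‖ₑ ^ p) := by
          gcongr
          exact kern_shift hb le_rfl ht w y
      _ = ENNReal.ofReal ((1 + t * ‖y‖) ^ b) * P ^ (1 - p) *
          ((kern b t w * ENNReal.ofReal ((1 + t * ‖w‖) ^ (b * (1 - p)))) * ‖g (x - w)‖ₑ ^ p) := by ring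
      _ = _ := by rw [e3]
  have hne : P ^ (1 - p) ≠ 0 := (ENNReal.rpow_pos (pos_iff_ne_zero.2 hP0) hfin).ne'
  have hne' : P ^ (1 - p) ≠ ∞ := ENNReal.rpow_ne_top_of_nonneg (by linarith) hfin
  rw [← ENNReal.mul_le_mul_iff_right hne hne', ← ENNReal.rpow_add_of_nonneg _ _ (by linarith) hp.le]
  simp only [sub_add_cancel, ENNReal.rpow_one]
  calc P ≤ _ := h1
    _ = _ := by ring

lemma peetre_big {n : ℕ} {E : Type*} [NormedAddCommGroup E] [NormedSpace ℂ E] {p b t : ℝ} (hp1 : 1 < p)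
     (hb : 0 ≤ b) (ht : 0 < t) (g : Rn n → E) (hg : Continuous g) (A : ℝ≥0∞)
    (hA : ∀ x, ‖g x‖ₑ ≤ A * ∫⁻ z, kern (b * p) t z * ‖g (x - z)‖ₑ) (x : Rn n) :
    peetreMax b t g x ^ p ≤ (A ^ p * II n (b * p) ^ (p - 1)) * GG p b t g x := by
  have hp : 0 < p := by linarith
  have h1 : peetreMax b t g x ≤ ((A ^ p * II n (b * p) ^ (p - 1)) * GG p b t g x) ^ (1 / p) := by
    apply peetre_le b ht.le
    intro y
    rw [← ENNReal.rpow_le_rpow_iff hp, ENNReal.mul_rpow_of_nonneg _ _ hp.le, ← ENNReal.rpow_mul, one_div,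
      inv_mul_cancel₀ hp.ne', ENNReal.rpow_one, ENNReal.ofReal_rpow_of_nonneg (by positivity) hp.le,
      ← Real.rpow_mul (by positivity)]
    have h2 := hA (x - y)
    rw [lint_shift (kern (b * p) t) (fun u => ‖g u‖ₑ)] at h2
    have hm2 : Measurable fun w => ‖g (x - w)‖ₑ := (Continuous.enorm (by fun_prop)).measurable
    have hm1 := kern_meas (n := n) (b * p) t
    have h3 := jensen (fun w => kern (b * p) t (w - y)) (fun w => ‖g (x - w)‖ₑ)
      (by fun_prop) hm2 hp1
    rw [lintegral_sub_right_eq_self (μ := volume) (fun z => kern (b * p) t z) y, kern_int _ ht] at h3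
    have h4 : ∫⁻ w, kern (b * p) t (w - y) * ‖g (x - w)‖ₑ ^ p ≤
        ENNReal.ofReal ((1 + t * ‖y‖) ^ (b * p)) * GG p b t g x := by
      rw [GG, ← lintegral_const_mul _ (by fun_prop)]
      apply lintegral_mono
      intro w
      simp only
      rw [← mul_assoc]
      gcongr
      exact kern_shift (by positivity) le_rfl ht w y
    calc ‖g (x - y)‖ₑ ^ p ≤ (A * ∫⁻ w, kern (b * p) t (w - y) * ‖g (x - w)‖ₑ) ^ p := by gcongr
      _ = A ^ p * (∫⁻ w, kern (b * p) t (w - y) * ‖g (x - w)‖ₑ) ^ p := ENNReal.mul_rpow_of_nonneg _ _ hp.le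
      _ ≤ A ^ p * (II n (b * p) ^ (p - 1) * (ENNReal.ofReal ((1 + t * ‖y‖) ^ (b * p)) * GG p b t g x)) := by
        gcongr; exact h3.trans (by gcongr)
      _ = _ := by ring
  calc _ ≤ (((A ^ p * II n (b * p) ^ (p - 1)) * GG p b t g x) ^ (1 / p)) ^ p := by gcongr
    _ = _ := by rw [← ENNReal.rpow_mul, one_div, inv_mul_cancel₀ hp.ne', ENNReal.rpow_one]

lemma GG_int {n : ℕ} {E : Type*} [NormedAddCommGroup E] {p b t : ℝ}
    (ht : 0 < t) (g : Rn n → E) (hg : Continuous g) :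
    ∫⁻ x, GG p b t g x = II n (b * p) * ∫⁻ x, ‖g x‖ₑ ^ p := by
  unfold GG
  have hm1 := kern_meas (n := n) (b * p) t
  have hm2 : Measurable fun w : Rn n × Rn n => ‖g (w.1 - w.2)‖ₑ := (Continuous.enorm (by fun_prop)).measurable
  rw [lintegral_lintegral_swap]
  · have : ∀ w, ∫⁻ x, kern (b * p) t w * ‖g (x - w)‖ₑ ^ p = kern (b * p) t w * ∫⁻ x, ‖g x‖ₑ ^ p := by
      intro w
      have hm3 : Measurable fun x => ‖g (x - w)‖ₑ := (Continuous.enorm (by fun_prop)).measurable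
      rw [lintegral_const_mul _ (by fun_prop),
        lintegral_sub_right_eq_self (μ := volume) (fun x => ‖g x‖ₑ ^ p) w]
    simp_rw [this]
    rw [lintegral_mul_const _ hm1, kern_int _ ht]
  · apply Measurable.aemeasurable
    unfold Function.uncurry
    fun_prop

lemma peetre_Lp {n : ℕ} {a : ℝ} {p : ℝ≥0∞} (hp : 0 < p) (ha : (n : ℝ) / p.toReal < a) :
    ∃ r : ℝ, ∀ A : ℝ≥0∞, A ≠ ∞ → ∃ C : ℝ≥0∞, C ≠ ∞ ∧ ∀ (E : Type*) [NormedAddCommGroup E]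
      [NormedSpace ℂ E] (g : Rn n → E) (t : ℝ), 0 < t → Continuous g →
      (∃ (m : ℕ) (D : ℝ), 0 ≤ D ∧ ∀ x, ‖g x‖ ≤ D * (1 + ‖x‖) ^ m) →
      (∀ b, ∃ A' : ℝ≥0∞, A' ≠ ∞ ∧ ∀ x, ‖g x‖ₑ ≤ A' * ∫⁻ z, kern b t z * ‖g (x - z)‖ₑ) →
      (∀ x, ‖g x‖ₑ ≤ A * ∫⁻ z, kern r t z * ‖g (x - z)‖ₑ) →
      lpNormENN p (peetreMax a t g) ≤ C * eLpNorm g p volume := by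
  have ha0 : 0 ≤ a := le_trans (by positivity) ha.le
  by_cases hpt : p = ∞
  · subst hpt
    refine ⟨n + 1, fun A hA => ⟨A * II n (n + 1), ENNReal.mul_ne_top hA (II_lt (by linarith)).ne, ?_⟩⟩
    intro E _ _ g t ht hg _ _ hA
    rw [lpNormENN, if_pos rfl, eLpNorm_exponent_top]
    refine essSup_le_of_ae_le _ ?_
    refine Eventually.of_forall fun x => ?_
    apply peetre_le a ht.le
    intro y
    have h1 : ‖g (x - y)‖ₑ ≤ A * II n (n + 1) * eLpNormEssSup g volume := by
      refine (hA _).trans ?_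
      rw [mul_assoc]
      gcongr
      rw [← kern_int _ ht, ← lintegral_mul_const _ (kern_meas _ _)]
      apply lintegral_mono_ae
      have := ae_le_eLpNormEssSup (f := g) (μ := (volume : Measure (Rn n)))
      have h2 := (Measure.measurePreserving_sub_left (volume : Measure (Rn n)) (x - y)).quasiMeasurePreserving.ae this
      filter_upwards [h2] with z hz
      gcongr
    refine h1.trans ?_
    apply le_mul_of_one_le_right zero_le
    rw [ENNReal.one_le_ofReal]
    apply Real.one_le_rpow _ ha0
    have : 0 ≤ t * ‖y‖ := by positivity
    linarith
  have hp0 : 0 < p.toReal := ENNReal.toReal_pos hp.ne' hpt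
  set P := p.toReal with hP
  have hap : (n : ℝ) < a * P := by rwa [div_lt_iff₀ hp0] at ha
  have hII := II_lt hap
  -- final step
  have fin : ∀ B : ℝ≥0∞, ∀ (E : Type _) [NormedAddCommGroup E] [NormedSpace ℂ E] (g : Rn n → E) (t : ℝ), 0 < t →
      Continuous g → (∀ x, peetreMax a t g x ^ P ≤ B * GG P a t g x) →
      lpNormENN p (peetreMax a t g) ≤ (B * II n (a * P)) ^ (1 / P) * eLpNorm g p volume := by
    intro B E _ _ g t ht hg h
    rw [lpNormENN, if_neg hpt, eLpNorm_eq_lintegral_rpow_enorm_toReal hp.ne' hpt,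
      ← ENNReal.mul_rpow_of_nonneg _ _ (by positivity)]
    gcongr
    refine (lintegral_mono h).trans ?_
    rw [lintegral_const_mul, GG_int ht g hg, mul_assoc]
    unfold GG
    have hm1 := kern_meas (n := n) (a * P) t
    have hm2 : Measurable fun w : Rn n × Rn n => ‖g (w.1 - w.2)‖ₑ := (Continuous.enorm (by fun_prop)).measurable
    apply Measurable.lintegral_prod_right' (f := fun w : Rn n × Rn n => kern (a * P) t w.2 * ‖g (w.1 - w.2)‖ₑ ^ P)
    fun_prop
  rcases le_or_gt P 1 with hP1 | hP1
  · refine ⟨a, fun A hA => ⟨((A + 1) * II n (a * P)) ^ (1 / P) + 1, ?_, ?_⟩⟩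
    · refine ENNReal.add_ne_top.2 ⟨ENNReal.rpow_ne_top_of_nonneg (by positivity) ?_, by simp⟩
      exact ENNReal.mul_ne_top (ENNReal.add_ne_top.2 ⟨hA, by simp⟩) hII.ne
    intro E _ _ g t ht hg hgr hA' hA
    by_cases htop : eLpNorm g p volume = ∞
    · rw [htop, ENNReal.mul_top (by simp)]; exact le_top
    have hmono : (A * II n (a * P)) ^ (1 / P) ≤ ((A + 1) * II n (a * P)) ^ (1 / P) + 1 := by
      refine le_add_right ?_
      gcongr
      exact le_self_add
    refine le_trans (fin A E g t ht hg ?_) (by gcongr)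
    -- boundedness
    have hint : ∫⁻ x, ‖g x‖ₑ ^ P ≠ ∞ := by
      intro h
      rw [eLpNorm_eq_lintegral_rpow_enorm_toReal hp.ne' hpt, h, ENNReal.top_rpow_of_pos (by positivity)] at htop
      exact htop rfl
    obtain ⟨m, D, hD, hgr⟩ := hgr
    obtain ⟨A', hA'1, hA'2⟩ := hA' m
    have hfin : ∀ x, peetreMax (m : ℝ) t g x ≠ ∞ := by
      intro x
      refine ne_top_of_le_ne_top (b := ENNReal.ofReal (D * ((1 + ‖x‖) * (1 + t⁻¹)) ^ m)) ENNReal.ofReal_ne_top ?_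
      apply peetre_le _ ht.le
      intro y
      rw [← ENNReal.ofReal_mul (by positivity), ← ofReal_norm]
      apply ENNReal.ofReal_le_ofReal
      refine (hgr _).trans ?_
      rw [Real.rpow_natCast, mul_assoc, ← mul_pow]
      gcongr
      have h1 : ‖x - y‖ ≤ ‖x‖ + ‖y‖ := norm_sub_le x y
      have h2 : (1 + t⁻¹) * (1 + t * ‖y‖) ≥ 1 + ‖y‖ := by
        have e : t⁻¹ * (t * ‖y‖) = ‖y‖ := inv_mul_cancel_left₀ ht.ne' _
        have : 0 ≤ t * ‖y‖ := by positivity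
        have : 0 ≤ t⁻¹ := by positivity
        nlinarith
      have : (1 + ‖x‖) * (1 + ‖y‖) ≤ (1 + ‖x‖) * ((1 + t⁻¹) * (1 + t * ‖y‖)) := by gcongr
      nlinarith [norm_nonneg x, norm_nonneg y]
    have hbd : ∀ x, ‖g x‖ₑ ^ P ≤ A' * (ENNReal.ofReal (t ^ n) * ∫⁻ x, ‖g x‖ₑ ^ P) := by
      intro x
      have h1 := peetre_small hp0 hP1 (by positivity) ht g hg A' hA'2 x (hfin x)
      calc ‖g x‖ₑ ^ P ≤ peetreMax (m : ℝ) t g x ^ P := by gcongr; exact le_peetre0 _ ht.le g x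
        _ ≤ _ := h1
        _ ≤ _ := by
          gcongr
          have hm3 : Measurable fun z => ‖g (x - z)‖ₑ := (Continuous.enorm (by fun_prop)).measurable
          rw [← lintegral_sub_left_eq_self (μ := volume) (fun z => ‖g z‖ₑ ^ P) x,
            ← lintegral_const_mul _ (by fun_prop), GG]
          apply lintegral_mono
          intro w
          simp only
          gcongr
          rw [kern]
          apply ENNReal.ofReal_le_ofReal
          apply mul_le_of_le_one_right (by positivity)
          apply Real.rpow_le_one_of_one_le_of_nonpos
          · have : 0 ≤ t * ‖w‖ := by positivity
            linarith
          · have : 0 ≤ (m : ℝ) * P := by positivity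
            linarith
    set B0 := A' * (ENNReal.ofReal (t ^ n) * ∫⁻ x, ‖g x‖ₑ ^ P) with hB0
    have hB0t : B0 ≠ ∞ := ENNReal.mul_ne_top hA'1 (ENNReal.mul_ne_top ENNReal.ofReal_ne_top hint)
    intro x
    apply peetre_small hp0 hP1 ha0 ht g hg A hA x
    refine ne_top_of_le_ne_top (b := B0 ^ (1 / P)) (ENNReal.rpow_ne_top_of_nonneg (by positivity) hB0t) ?_
    apply peetre_le a ht.le
    intro y
    have h1 : ‖g (x - y)‖ₑ ≤ B0 ^ (1 / P) := by
      rw [← ENNReal.rpow_le_rpow_iff hp0, ← ENNReal.rpow_mul, one_div, inv_mul_cancel₀ hp0.ne', ENNReal.rpow_one]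
      exact hbd _
    refine h1.trans ?_
    apply le_mul_of_one_le_right zero_le
    rw [ENNReal.one_le_ofReal]
    apply Real.one_le_rpow _ ha0
    have : 0 ≤ t * ‖y‖ := by positivity
    linarith
  · refine ⟨a * P, fun A hA => ⟨(A ^ P * II n (a * P) ^ (P - 1) * II n (a * P)) ^ (1 / P), ?_, ?_⟩⟩
    · refine ENNReal.rpow_ne_top_of_nonneg (by positivity) (ENNReal.mul_ne_top (ENNReal.mul_ne_top ?_ ?_) hII.ne)
      · exact ENNReal.rpow_ne_top_of_nonneg (by positivity) hA
      · exact ENNReal.rpow_ne_top_of_nonneg (by linarith) hII.ne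
    intro E _ _ g t ht hg hgr hA' hA
    exact fin _ E g t ht hg fun x => peetre_big hP1 ha0 ht g hg A hA x

end BP

namespace BP

/-- distance of naturals -/
def nd (l j : ℕ) : ℕ := (l - j) + (j - l)

lemma nd_comm (l j : ℕ) : nd l j = nd j l := by unfold nd; omega

lemma tsum_nd (r : ℝ≥0∞) (l : ℕ) : ∑' j, r ^ nd l j ≤ 2 * ∑' k, r ^ k := by
  have h1 : ∀ j, r ^ nd l j ≤ (if j ≤ l then r ^ (l - j) else 0) + (if l ≤ j then r ^ (j - l) else 0) := by
    intro j
    unfold nd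
    split_ifs with h1 h2 h2
    · simp [show l = j by omega]
    · simp [show j - l = 0 by omega]
    · simp [show l - j = 0 by omega]
    · omega
  refine (ENNReal.tsum_le_tsum h1).trans ?_
  rw [ENNReal.tsum_add, two_mul]
  gcongr ?_ + ?_
  · rw [tsum_eq_sum (s := Finset.range (l + 1)) (by
      intro j hj; rw [if_neg]; simpa using hj)]
    have : ∑ j ∈ Finset.range (l + 1), (if j ≤ l then r ^ (l - j) else 0)
        = ∑ j ∈ Finset.range (l + 1), r ^ j := by
      rw [← Finset.sum_range_reflect (fun j => r ^ j) (l + 1)]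
      apply Finset.sum_congr rfl
      intro j hj
      rw [Finset.mem_range] at hj
      rw [if_pos (by omega)]
      congr 1
    rw [this]
    exact ENNReal.sum_le_tsum _
  · have hinj : Function.Injective fun k => l + k := fun a b h => by simpa using h
    rw [← hinj.tsum_eq]
    · simp
    · intro j hj
      simp only [Function.mem_support] at hj
      by_cases h : l ≤ j
      · exact ⟨j - l, by simp; omega⟩
      · simp [h] at hj

lemma tsum_geom_ne {r : ℝ≥0∞} (hr : r < 1) : ∑' k : ℕ, r ^ k ≠ ∞ := by
  rw [ENNReal.tsum_geometric]
  simp [tsub_eq_zero_iff_le, hr]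

lemma lqSum_mono {q : ℝ≥0∞} {a b : ℕ → ℝ≥0∞} (h : ∀ j, a j ≤ b j) : lqSum q a ≤ lqSum q b := by
  unfold lqSum
  split_ifs
  · exact iSup_mono h
  · gcongr; exact h _

lemma lqSum_const {q : ℝ≥0∞} (c : ℝ≥0∞) {a : ℕ → ℝ≥0∞} (hq : 0 < q) :
    lqSum q (fun j => c * a j) = c * lqSum q a := by
  unfold lqSum
  split_ifs with hqt
  · rw [ENNReal.mul_iSup]
  · have hq0 : 0 < q.toReal := ENNReal.toReal_pos hq.ne' hqt
    simp_rw [ENNReal.mul_rpow_of_nonneg _ _ hq0.le]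
    rw [ENNReal.tsum_mul_left, ENNReal.mul_rpow_of_nonneg _ _ (by positivity), ← ENNReal.rpow_mul, one_div,
      mul_inv_cancel₀ hq0.ne', ENNReal.rpow_one]

lemma lqSum_mul_le {q : ℝ≥0∞} (hq : 0 < q) (v w : ℕ → ℝ≥0∞) :
    lqSum q (fun j => v j * w j) ≤ lqSum q v * ⨆ j, w j := by
  rw [mul_comm, ← lqSum_const _ hq]
  apply lqSum_mono
  intro j
  rw [mul_comm]
  gcongr
  exact le_iSup w j

/-- the constant -/
def cq (q : ℝ≥0∞) (r : ℝ≥0∞) : ℝ≥0∞ :=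
  if q = ∞ then 1 else (2 * ∑' k : ℕ, (r ^ q.toReal) ^ k) ^ (1 / q.toReal)

lemma cq_ne {q r : ℝ≥0∞} (hq : 0 < q) (hr : r < 1) : cq q r ≠ ∞ := by
  unfold cq
  split_ifs with hqt
  · simp
  · have hq0 : 0 < q.toReal := ENNReal.toReal_pos hq.ne' hqt
    apply ENNReal.rpow_ne_top_of_nonneg (by positivity)
    exact ENNReal.mul_ne_top (by simp) (tsum_geom_ne (ENNReal.rpow_lt_one hr hq0))

lemma pow_rpow_comm (r : ℝ≥0∞) (k : ℕ) (q : ℝ) : (r ^ k) ^ q = (r ^ q) ^ k := by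
  rw [← ENNReal.rpow_natCast, ← ENNReal.rpow_natCast, ← ENNReal.rpow_mul, ← ENNReal.rpow_mul, mul_comm]

lemma lqSum_nd {q r : ℝ≥0∞} (hr : r < 1) (l : ℕ) : lqSum q (fun j => r ^ nd l j) ≤ cq q r := by
  unfold lqSum cq
  split_ifs with hqt
  · exact iSup_le fun j => pow_le_one₀ zero_le hr.le
  · simp_rw [pow_rpow_comm]
    gcongr
    exact tsum_nd _ l

lemma lqSum_sup {q r : ℝ≥0∞} (hq : 0 < q) (hr : r < 1) (A : ℕ → ℝ≥0∞) :
    lqSum q (fun l => ⨆ j, r ^ nd l j * A j) ≤ cq q r * lqSum q A := by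
  unfold lqSum cq
  split_ifs with hqt
  · rw [one_mul]
    refine iSup_le fun l => iSup_le fun j => (mul_le_of_le_one_left zero_le ?_).trans (le_iSup A j)
    exact pow_le_one₀ zero_le hr.le
  · have hq0 : 0 < q.toReal := ENNReal.toReal_pos hq.ne' hqt
    rw [← ENNReal.mul_rpow_of_nonneg _ _ (by positivity)]
    gcongr
    calc ∑' l, (⨆ j, r ^ nd l j * A j) ^ q.toReal ≤ ∑' l, ∑' j, (r ^ nd l j * A j) ^ q.toReal := by
          gcongr with l
          have : ⨆ j, r ^ nd l j * A j ≤ (∑' j, (r ^ nd l j * A j) ^ q.toReal) ^ (1 / q.toReal) := by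
            refine iSup_le fun j => ?_
            rw [← ENNReal.rpow_le_rpow_iff hq0, ← ENNReal.rpow_mul, one_div, inv_mul_cancel₀ hq0.ne', ENNReal.rpow_one]
            exact ENNReal.le_tsum j
          rw [← ENNReal.rpow_le_rpow_iff hq0, ← ENNReal.rpow_mul, one_div, inv_mul_cancel₀ hq0.ne', ENNReal.rpow_one] at this
          exact this
      _ = ∑' j, ∑' l, (r ^ nd l j * A j) ^ q.toReal := ENNReal.tsum_comm
      _ = ∑' j, (∑' l, (r ^ q.toReal) ^ nd j l) * A j ^ q.toReal := by
          congr 1; ext j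
          rw [← ENNReal.tsum_mul_right]
          congr 1; ext l
          rw [ENNReal.mul_rpow_of_nonneg _ _ hq0.le, pow_rpow_comm, nd_comm]
      _ ≤ ∑' j, (2 * ∑' k : ℕ, (r ^ q.toReal) ^ k) * A j ^ q.toReal := by
          gcongr with j
          exact tsum_nd _ j
      _ = _ := ENNReal.tsum_mul_left

lemma lp_sup {n : ℕ} {p : ℝ≥0∞} (hp : 0 < p) (g : ℕ → Rn n → ℝ≥0∞) (hg : ∀ j, Measurable (g j)) :
    lpNormENN p (fun x => ⨆ j, g j x) ≤ lqSum p (fun j => lpNormENN p (g j)) := by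
  unfold lpNormENN lqSum
  split_ifs with hpt
  · refine essSup_le_of_ae_le _ ?_
    have : ∀ᵐ x, ∀ j, g j x ≤ essSup (g j) volume := ae_all_iff.2 fun j => ENNReal.ae_le_essSup (g j)
    filter_upwards [this] with x hx
    exact iSup_mono hx
  · have hp0 : 0 < p.toReal := ENNReal.toReal_pos hp.ne' hpt
    gcongr
    simp_rw [← ENNReal.rpow_mul, one_div, inv_mul_cancel₀ hp0.ne', ENNReal.rpow_one]
    rw [← lintegral_tsum (fun j => ((hg j).pow_const _).aemeasurable)]
    apply lintegral_mono
    intro x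
    have : ⨆ j, g j x ≤ (∑' j, g j x ^ p.toReal) ^ (1 / p.toReal) := by
      refine iSup_le fun j => ?_
      rw [← ENNReal.rpow_le_rpow_iff hp0, ← ENNReal.rpow_mul, one_div, inv_mul_cancel₀ hp0.ne', ENNReal.rpow_one]
      exact ENNReal.le_tsum (f := fun j => g j x ^ p.toReal) j
    rw [← ENNReal.rpow_le_rpow_iff hp0, ← ENNReal.rpow_mul, one_div, inv_mul_cancel₀ hp0.ne', ENNReal.rpow_one] at this
    exact this

lemma lp_mono {n : ℕ} {p : ℝ≥0∞} {g h : Rn n → ℝ≥0∞} (H : ∀ x, g x ≤ h x) :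
    lpNormENN p g ≤ lpNormENN p h := by
  unfold lpNormENN
  split_ifs
  · exact essSup_mono_ae (Eventually.of_forall H)
  · gcongr; exact H _

lemma lp_const {n : ℕ} {p : ℝ≥0∞} (hp : 0 < p) {c : ℝ≥0∞} (hc : c ≠ ∞) (g : Rn n → ℝ≥0∞) :
    lpNormENN p (fun x => c * g x) = c * lpNormENN p g := by
  unfold lpNormENN
  split_ifs with hpt
  · exact ENNReal.essSup_const_mul
  · have hp0 : 0 < p.toReal := ENNReal.toReal_pos hp.ne' hpt
    simp_rw [ENNReal.mul_rpow_of_nonneg _ _ hp0.le]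
    rw [lintegral_const_mul' _ _ (ENNReal.rpow_ne_top_of_nonneg hp0.le hc),
      ENNReal.mul_rpow_of_nonneg _ _ (by positivity), ← ENNReal.rpow_mul, one_div,
      mul_inv_cancel₀ hp0.ne', ENNReal.rpow_one]

lemma lp_enorm {n : ℕ} {E : Type*} [NormedAddCommGroup E] {p : ℝ≥0∞} (hp : 0 < p) (g : Rn n → E) :
    lpNormENN p (fun x => ‖g x‖ₑ) = eLpNorm g p volume := by
  unfold lpNormENN
  split_ifs with hpt
  · subst hpt; rw [eLpNorm_exponent_top]; rfl
  · rw [eLpNorm_eq_lintegral_rpow_enorm_toReal hp.ne' hpt]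

lemma seq_bd {p q r : ℝ≥0∞} (hp : 0 < p) (hq : 0 < q) (hr : r < 1) :
    ∃ C : ℝ≥0∞, C ≠ ∞ ∧ ∀ {n : ℕ} (a b : ℕ → Rn n → ℝ≥0∞), (∀ j, Measurable (a j)) →
      (∀ l x, b l x ≤ ∑' j, r ^ nd l j * a j x) →
      lqSum q (fun l => lpNormENN p (b l)) ≤ C * lqSum q (fun j => lpNormENN p (a j)) := by
  set ρ := r ^ (1 / 3 : ℝ) with hρ
  have hρ1 : ρ < 1 := ENNReal.rpow_lt_one hr (by norm_num)
  have hρr : ρ * ρ * ρ = r := by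
    rw [hρ, ← ENNReal.rpow_add_of_nonneg _ _ (by norm_num) (by norm_num),
      ← ENNReal.rpow_add_of_nonneg _ _ (by norm_num) (by norm_num)]
    norm_num
  have hc : 2 * ∑' k, ρ ^ k ≠ ∞ := ENNReal.mul_ne_top (by simp) (tsum_geom_ne hρ1)
  refine ⟨(2 * ∑' k, ρ ^ k) * cq p ρ * cq q ρ, ENNReal.mul_ne_top (ENNReal.mul_ne_top hc (cq_ne hp hρ1)) (cq_ne hq hρ1), ?_⟩
  intro n a b ha hb
  have h1 : ∀ l x, b l x ≤ (2 * ∑' k, ρ ^ k) * ⨆ j, (ρ ^ nd l j * ρ ^ nd l j) * a j x := by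
    intro l x
    refine (hb l x).trans ?_
    calc ∑' j, r ^ nd l j * a j x ≤ ∑' j, ρ ^ nd l j * ⨆ j, (ρ ^ nd l j * ρ ^ nd l j) * a j x := by
          refine ENNReal.tsum_le_tsum fun j => ?_
          have e : r ^ nd l j * a j x = ρ ^ nd l j * ((ρ ^ nd l j * ρ ^ nd l j) * a j x) := by
            rw [← hρr, mul_pow, mul_pow]; ring
          rw [e]
          exact mul_le_mul_right (le_iSup (fun j => (ρ ^ nd l j * ρ ^ nd l j) * a j x) j) _
      _ = (∑' j, ρ ^ nd l j) * ⨆ j, (ρ ^ nd l j * ρ ^ nd l j) * a j x := ENNReal.tsum_mul_right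
      _ ≤ _ := by gcongr; exact tsum_nd _ l
  have h2 : ∀ l, lpNormENN p (b l) ≤
      (2 * ∑' k, ρ ^ k) * (cq p ρ * ⨆ j, ρ ^ nd l j * lpNormENN p (a j)) := by
    intro l
    refine (lp_mono (h1 l)).trans ?_
    rw [lp_const hp hc]
    gcongr
    refine (lp_sup hp _ fun j => (ha j).const_mul _).trans ?_
    have : ∀ j, lpNormENN p (fun x => (ρ ^ nd l j * ρ ^ nd l j) * a j x) =
        ρ ^ nd l j * (ρ ^ nd l j * lpNormENN p (a j)) := by
      intro j
      have : ρ ^ nd l j ≠ ∞ := ENNReal.pow_ne_top (hρ1.trans ENNReal.one_lt_top).ne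
      rw [lp_const hp (ENNReal.mul_ne_top this this), mul_assoc]
    simp_rw [this]
    refine (lqSum_mul_le hp _ _).trans ?_
    gcongr
    exact lqSum_nd hρ1 l
  refine (lqSum_mono h2).trans ?_
  rw [lqSum_const _ hq, lqSum_const _ hq, mul_assoc (_ * cq p ρ), mul_assoc (2 * _) (cq p ρ)]
  exact mul_le_mul_right (mul_le_mul_right (lqSum_sup hq hρ1 _) _) _

lemma peetre_meas {n : ℕ} {E : Type*} [NormedAddCommGroup E] [NormedSpace ℂ E] (a t : ℝ) (g : Rn n → E)
    (hg : Continuous g) (h0 : 0 ≤ t) : Measurable (peetreMax a t g) := by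
  apply LowerSemicontinuous.measurable
  unfold peetreMax
  apply lowerSemicontinuous_iSup
  intro y
  apply Continuous.lowerSemicontinuous
  have hpos : 0 < (1 + t * ‖y‖) ^ a := by positivity
  apply ENNReal.continuous_div_const _ (by simpa using hpos) |>.comp
  exact Continuous.enorm (f := fun x => g (x - y)) (by fun_prop)

lemma lqSum_split {q : ℝ≥0∞} (hq : 0 < q) : ∃ C : ℝ≥0∞, C ≠ ∞ ∧ ∀ a : ℕ → ℝ≥0∞,
    a 0 + lqSum q (fun j => a (j + 1)) ≤ 2 * lqSum q a ∧
    lqSum q a ≤ C * (a 0 + lqSum q (fun j => a (j + 1))) := by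
  by_cases hqt : q = ∞
  · refine ⟨1, by simp, fun a => ?_⟩
    simp only [lqSum, if_pos hqt]
    constructor
    · rw [two_mul]
      exact add_le_add (le_iSup a 0) (iSup_le fun j => le_iSup a (j + 1))
    · rw [one_mul]
      refine iSup_le fun j => ?_
      rcases j with _ | j
      · exact le_self_add
      · exact (le_iSup (fun j => a (j + 1)) j).trans le_add_self
  · have hq0 : 0 < q.toReal := ENNReal.toReal_pos hq.ne' hqt
    refine ⟨2 ^ (1 / q.toReal), ENNReal.rpow_ne_top_of_nonneg (by positivity) (by simp), fun a => ?_⟩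
    simp only [lqSum, if_neg hqt]
    have e : ∀ x : ℝ≥0∞, (x ^ q.toReal) ^ (1 / q.toReal) = x := by
      intro x
      rw [← ENNReal.rpow_mul, one_div, mul_inv_cancel₀ hq0.ne', ENNReal.rpow_one]
    have e' : ∀ x : ℝ≥0∞, (x ^ (1 / q.toReal)) ^ q.toReal = x := by
      intro x
      rw [← ENNReal.rpow_mul, one_div, inv_mul_cancel₀ hq0.ne', ENNReal.rpow_one]
    have hs : ∑' j, a j ^ q.toReal = a 0 ^ q.toReal + ∑' j, a (j + 1) ^ q.toReal :=
      tsum_eq_zero_add' ENNReal.summable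
    rw [hs]
    constructor
    · rw [two_mul]
      gcongr
      · conv_lhs => rw [← e (a 0)]
        gcongr
        exact le_self_add
      · exact le_add_self
    · set T := (∑' j, a (j + 1) ^ q.toReal) ^ (1 / q.toReal) with hT
      have h1 : ∑' j, a (j + 1) ^ q.toReal = T ^ q.toReal := by rw [hT, e']
      rw [h1]
      calc (a 0 ^ q.toReal + T ^ q.toReal) ^ (1 / q.toReal)
          ≤ ((a 0 + T) ^ q.toReal + (a 0 + T) ^ q.toReal) ^ (1 / q.toReal) := by
            gcongr
            · exact le_self_add
            · exact le_add_self
        _ = _ := by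
          rw [← two_mul, ENNReal.mul_rpow_of_nonneg _ _ (by positivity), e]

end BP

namespace BP

lemma res_zero_lo {n : ℕ} {φ : ℕ → Sch n} (hφ : SmoothResolution n φ) {j : ℕ} {ξ : Rn n}
    (h : 2 * ‖ξ‖ < 2 ^ j) (hj : 0 < j) : φ j ξ = 0 := by
  by_contra hne
  have h1 := (hφ.suppj j hj (Function.mem_support.2 hne)).1
  rw [Real.rpow_sub (by norm_num), Real.rpow_natCast, Real.rpow_one] at h1
  linarith

lemma res_zero_hi' {n : ℕ} {φ : ℕ → Sch n} (hφ : SmoothResolution n φ) {j : ℕ} {ξ : Rn n}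
    (h : 2 ^ (j + 1) < ‖ξ‖) : φ j ξ = 0 := by
  by_contra hne
  rcases Nat.eq_zero_or_pos j with rfl | hj
  · have h1 := hφ.supp0 (Function.mem_support.2 hne)
    simp at h1 h
    linarith
  · have h1 := (hφ.suppj j hj (Function.mem_support.2 hne)).2
    have : (2:ℝ) ^ ((j:ℝ) + 1) = 2 ^ (j + 1) := by
      rw [← Real.rpow_natCast]; push_cast; rfl
    rw [this] at h1
    linarith

lemma res_zero_hi {n : ℕ} {φ : ℕ → Sch n} (hφ : SmoothResolution n φ) {j : ℕ} {ξ : Rn n}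
    (h : 2 ^ (j + 1) ≤ ‖ξ‖) : φ j ξ = 0 := by
  by_contra hne
  have hc : ContinuousAt (fun s : ℝ => φ j (s • ξ)) 1 :=
    ((φ j).continuous.comp (continuous_id.smul continuous_const)).continuousAt
  have h1 : ∀ᶠ s in 𝓝 (1:ℝ), φ j (s • ξ) ≠ 0 := hc.eventually_ne (by simpa using hne)
  have h2 : ∀ᶠ s in 𝓝[>] (1:ℝ), φ j (s • ξ) ≠ 0 := h1.filter_mono nhdsWithin_le_nhds
  have h3 : ∀ᶠ s in 𝓝[>] (1:ℝ), 1 < s := self_mem_nhdsWithin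
  obtain ⟨s, hs, hs1⟩ := (h2.and h3).exists
  apply hs
  apply res_zero_hi' hφ
  rw [norm_smul, Real.norm_of_nonneg (by linarith)]
  have : (0:ℝ) < 2 ^ (j + 1) := by positivity
  nlinarith

/-- neighbouring sum -/
def tt {n : ℕ} (φ : ℕ → Sch n) (j : ℕ) : Sch n := ∑ i ∈ Finset.Icc (j - 1) (j + 1), φ i

lemma tt_apply {n : ℕ} (φ : ℕ → Sch n) (j : ℕ) (ξ : Rn n) :
    tt φ j ξ = ∑ i ∈ Finset.Icc (j - 1) (j + 1), φ i ξ := by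
  simp [tt]

lemma tt_mul {n : ℕ} {φ : ℕ → Sch n} (hφ : SmoothResolution n φ) (j : ℕ) :
    mulS (tt φ j) (φ j) = φ j := by
  ext ξ
  rw [mulS_apply]
  by_cases h : φ j ξ = 0
  · rw [h, mul_zero]
  have hu : ‖ξ‖ < 2 ^ (j + 1) := by
    by_contra hh; exact h (res_zero_hi hφ (not_lt.1 hh))
  have : tt φ j ξ = 1 := by
    rw [tt_apply, ← hφ.sum_eq ξ, eq_comm]
    apply tsum_eq_sum
    intro i hi
    rw [Finset.mem_Icc, not_and_or, not_le, not_le] at hi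
    rcases hi with hi | hi
    · apply res_zero_hi hφ
      by_contra hh
      apply h
      apply res_zero_lo hφ _ (by omega)
      rw [not_le] at hh
      have : (2:ℝ) ^ (i + 2) ≤ 2 ^ j := pow_le_pow_right₀ (by norm_num) (by omega)
      rw [pow_succ] at this hh
      rw [pow_succ] at this
      linarith
    · apply res_zero_lo hφ _ (by omega)
      have : (2:ℝ) ^ (j + 2) ≤ 2 ^ i := pow_le_pow_right₀ (by norm_num) (by omega)
      have e : (2:ℝ) ^ (j + 2) = 2 * 2 ^ (j + 1) := by ring
      linarith
  rw [this, one_mul]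

lemma res_part {n : ℕ} {φ : ℕ → Sch n} (hφ : SmoothResolution n φ) (J : ℕ) (ξ : Rn n)
    (h : ‖ξ‖ < 2 ^ J) : ∑ j ∈ Finset.range (J + 1), φ j ξ = 1 := by
  rw [← hφ.sum_eq ξ, eq_comm]
  apply tsum_eq_sum
  intro i hi
  rw [Finset.mem_range, not_lt] at hi
  apply res_zero_lo hφ _ (by omega)
  have : (2:ℝ) ^ (J + 1) ≤ 2 ^ i := pow_le_pow_right₀ (by norm_num) (by omega)
  rw [pow_succ] at this
  linarith

lemma dil_deriv {n : ℕ} (g : Sch n) {t : ℝ} (ht : 0 < t) (k : ℕ) (x : Rn n) :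
    ‖iteratedFDeriv ℝ k (dilate g t) x‖ = t ^ k * ‖iteratedFDeriv ℝ k g (t • x)‖ := by
  have e : (⇑(dilate g t)) = fun y => g (t • y) := by
    ext y; exact dilate_apply g ht.ne' y
  rw [e, iteratedFDeriv_comp_const_smul _ (g.smooth _), norm_smul, norm_pow, Real.norm_of_nonneg ht.le]

lemma res_deriv {n : ℕ} {φ : ℕ → Sch n} (hφ : SmoothResolution n φ) (k : ℕ) :
    ∃ C : ℝ, 0 ≤ C ∧ ∀ j ξ, ‖iteratedFDeriv ℝ k (φ j) ξ‖ ≤ C * (((2:ℝ) ^ j)⁻¹) ^ k := by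
  choose c hc using hφ.deriv_bound
  refine ⟨∑ r : Fin k → Fin n, |c (cnt r)|, Finset.sum_nonneg fun _ _ => abs_nonneg _, ?_⟩
  intro j ξ
  refine (iterated_le k (φ j) ξ).trans ?_
  rw [Finset.sum_mul]
  refine Finset.sum_le_sum fun r _ => ?_
  refine (hc (cnt r) j ξ).trans ?_
  rw [mdeg_cnt]
  have : (2:ℝ) ^ (-(j:ℝ) * (k:ℝ)) = (((2:ℝ) ^ j)⁻¹) ^ k := by
    rw [Real.rpow_mul (by norm_num), Real.rpow_neg (by norm_num), Real.rpow_natCast, Real.rpow_natCast]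
  rw [this]
  gcongr
  exact le_abs_self _

lemma dil_bd {n : ℕ} {φ : ℕ → Sch n} (hφ : SmoothResolution n φ) (m : ℕ) :
    ∃ B : ℝ, 0 ≤ B ∧ ∀ i j, j ≤ i + 1 → ∀ k ≤ m, ∀ x,
      ‖iteratedFDeriv ℝ k (dilate (φ i) (2 ^ j)) x‖ ≤ B := by
  choose C hC0 hC using res_deriv hφ
  refine ⟨∑ k ∈ Finset.range (m + 1), C k * 2 ^ k, Finset.sum_nonneg fun k _ => by
    have := hC0 k; positivity, ?_⟩
  intro i j hij k hk x
  rw [dil_deriv _ (by positivity)]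
  have h1 : ((2:ℝ) ^ j) ^ k * (((2:ℝ) ^ i)⁻¹) ^ k ≤ 2 ^ k := by
    rw [← mul_pow]
    gcongr
    rw [← div_eq_mul_inv, div_le_iff₀ (by positivity)]
    calc (2:ℝ) ^ j ≤ 2 ^ (i + 1) := pow_le_pow_right₀ (by norm_num) hij
      _ = _ := by ring
  calc _ ≤ ((2:ℝ) ^ j) ^ k * (C k * (((2:ℝ) ^ i)⁻¹) ^ k) := by gcongr; exact hC k i _
    _ = C k * (((2:ℝ) ^ j) ^ k * (((2:ℝ) ^ i)⁻¹) ^ k) := by ring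
    _ ≤ C k * 2 ^ k := mul_le_mul_of_nonneg_left h1 (hC0 k)
    _ ≤ _ := Finset.single_le_sum (f := fun k => C k * 2 ^ k) (fun k _ => by
        have := hC0 k; positivity) (Finset.mem_range.2 (by omega))

lemma tt_dil_bd {n : ℕ} {φ : ℕ → Sch n} (hφ : SmoothResolution n φ) (m : ℕ) :
    ∃ B : ℝ, 0 ≤ B ∧ ∀ j, ∀ k ≤ m, ∀ x,
      ‖iteratedFDeriv ℝ k (dilate (tt φ j) (2 ^ j)) x‖ ≤ B := by
  obtain ⟨B, hB, h⟩ := dil_bd hφ m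
  refine ⟨3 * B, by positivity, fun j k hk x => ?_⟩
  have e : (⇑(dilate (tt φ j) (2 ^ j))) = fun y => ∑ i ∈ Finset.Icc (j - 1) (j + 1), dilate (φ i) (2 ^ j) y := by
    ext y
    rw [dilate_apply _ (by positivity), tt_apply]
    refine Finset.sum_congr rfl fun i _ => ?_
    rw [dilate_apply _ (by positivity)]
  rw [e]
  rw [iteratedFDeriv_fun_sum_apply (fun i _ => ((dilate (φ i) (2 ^ j)).smooth _).contDiffAt)]
  calc _ ≤ ∑ i ∈ Finset.Icc (j - 1) (j + 1), B := by
        refine norm_sum_le_of_le _ fun i hi => h i j ?_ k hk x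
        rw [Finset.mem_Icc] at hi; omega
    _ ≤ _ := by
        rw [Finset.sum_const, Nat.card_Icc, nsmul_eq_mul]
        gcongr
        have : j + 1 + 1 - (j - 1) ≤ 3 := by omega
        exact_mod_cast this

lemma tt_dil_supp {n : ℕ} {φ : ℕ → Sch n} (hφ : SmoothResolution n φ) (j : ℕ) (x : Rn n)
    (hx : dilate (tt φ j) (2 ^ j) x ≠ 0) : ‖x‖ ≤ 4 ∧ (2 ≤ j → 1 / 4 ≤ ‖x‖) := by
  rw [dilate_apply _ (by positivity), tt_apply] at hx
  obtain ⟨i, hi, hne⟩ := Finset.exists_ne_zero_of_sum_ne_zero hx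
  rw [Finset.mem_Icc] at hi
  have hn : ‖(2:ℝ) ^ j • x‖ = 2 ^ j * ‖x‖ := by rw [norm_smul]; simp
  have hp : (0:ℝ) < 2 ^ j := by positivity
  constructor
  · by_contra hh
    apply hne
    apply res_zero_hi hφ
    rw [hn]
    have : (2:ℝ) ^ (i + 1) ≤ 2 ^ (j + 2) := pow_le_pow_right₀ (by norm_num) (by omega)
    rw [pow_add 2 j] at this
    nlinarith
  · intro hj
    by_contra hh
    apply hne
    apply res_zero_lo hφ _ (by omega)
    rw [hn]
    have : (2:ℝ) ^ j ≤ 2 ^ (i + 1) := pow_le_pow_right₀ (by norm_num) (by omega)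
    rw [pow_succ] at this
    nlinarith

lemma mul_nrm {n : ℕ} (m : ℕ) (u θ : Sch n) (Z : Set (Rn n)) (hZ : IsClosed Z)
    (hs : ∀ x, θ x ≠ 0 → x ∈ Z) {R : ℝ} (hR : 1 ≤ R) (hZR : ∀ x ∈ Z, ‖x‖ ≤ R) {A B : ℝ}
    (hA : 0 ≤ A) (hB : 0 ≤ B)
    (hu : ∀ k ≤ m, ∀ x ∈ Z, ‖iteratedFDeriv ℝ k u x‖ ≤ A)
    (hθ : ∀ k ≤ m, ∀ x, ‖iteratedFDeriv ℝ k θ x‖ ≤ B) :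
    nrm m (mulS u θ) ≤ R ^ m * 2 ^ m * A * B := by
  apply nrm_le _ _ _ (by positivity)
  intro k hk i hi x
  by_cases hx : x ∈ Z
  · have h1 : ‖iteratedFDeriv ℝ i (mulS u θ) x‖ ≤ 2 ^ m * A * B := by
      have e : (⇑(mulS u θ)) = fun y => u y * θ y := rfl
      rw [e]
      refine (norm_iteratedFDeriv_mul_le (u.smooth ⊤) (θ.smooth ⊤) x (n := i) (by exact_mod_cast le_top)).trans ?_
      calc _ ≤ ∑ j ∈ Finset.range (i + 1), (i.choose j : ℝ) * (A * B) := by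
            refine Finset.sum_le_sum fun j hj => ?_
            rw [Finset.mem_range] at hj
            rw [mul_assoc]
            gcongr
            · exact hu j (by omega) x hx
            · exact hθ _ (by omega) x
        _ = 2 ^ i * A * B := by
            rw [← Finset.sum_mul]
            have : (∑ j ∈ Finset.range (i + 1), (i.choose j : ℝ)) = 2 ^ i := by
              exact_mod_cast Nat.sum_range_choose i
            rw [this]; ring
        _ ≤ _ := by gcongr; norm_num
    calc _ ≤ R ^ m * (2 ^ m * A * B) := by
          gcongr
          exact (pow_le_pow_left₀ (norm_nonneg _) (hZR x hx) k).trans (pow_le_pow_right₀ hR hk)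
      _ = _ := by ring
  · have h0 : (⇑(mulS u θ)) =ᶠ[𝓝 x] fun _ => 0 := by
      filter_upwards [hZ.isOpen_compl.mem_nhds hx] with y hy
      have : θ y = 0 := by by_contra hh; exact hy (hs y hh)
      rw [mulS_apply, this, mul_zero]
    rw [(h0.iteratedFDeriv ℝ i).eq_of_nhds]
    simp
    positivity

end BP

namespace BP

lemma res_bd {n : ℕ} {φ : ℕ → Sch n} (hφ : SmoothResolution n φ) (m : ℕ) :
    ∃ B : ℝ, 0 ≤ B ∧ ∀ j, ∀ k ≤ m, ∀ x, ‖iteratedFDeriv ℝ k (φ j) x‖ ≤ B := by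
  choose C hC0 hC using res_deriv hφ
  refine ⟨∑ k ∈ Finset.range (m + 1), C k, Finset.sum_nonneg fun k _ => hC0 k, ?_⟩
  intro j k hk x
  calc _ ≤ C k * (((2:ℝ) ^ j)⁻¹) ^ k := hC k j x
    _ ≤ C k * 1 := by
        refine mul_le_mul_of_nonneg_left (pow_le_one₀ (by positivity) ?_) (hC0 k)
        exact inv_le_one_of_one_le₀ (one_le_pow₀ (by norm_num))
    _ = C k := mul_one _
    _ ≤ _ := Finset.single_le_sum (f := C) (fun k _ => hC0 k) (Finset.mem_range.2 (by omega))

lemma leib {n : ℕ} (u θ : Sch n) (i : ℕ) (x : Rn n) {A B : ℝ}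
    (hA : ∀ k ≤ i, ‖iteratedFDeriv ℝ k u x‖ ≤ A) (hB : ∀ k ≤ i, ‖iteratedFDeriv ℝ k θ x‖ ≤ B) :
    ‖iteratedFDeriv ℝ i (mulS u θ) x‖ ≤ 2 ^ i * A * B := by
  have hA0 : 0 ≤ A := (norm_nonneg _).trans (hA 0 (by omega))
  have hB0 : 0 ≤ B := (norm_nonneg _).trans (hB 0 (by omega))
  have e : (⇑(mulS u θ)) = fun y => u y * θ y := rfl
  rw [e]
  refine (norm_iteratedFDeriv_mul_le (u.smooth ⊤) (θ.smooth ⊤) x (n := i) (by exact_mod_cast le_top)).trans ?_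
  calc _ ≤ ∑ j ∈ Finset.range (i + 1), (i.choose j : ℝ) * (A * B) := by
        refine Finset.sum_le_sum fun j hj => ?_
        rw [Finset.mem_range] at hj
        rw [mul_assoc]
        gcongr
        · exact hA j (by omega)
        · exact hB _ (by omega)
    _ = 2 ^ i * A * B := by
        rw [← Finset.sum_mul]
        have : (∑ j ∈ Finset.range (i + 1), (i.choose j : ℝ)) = 2 ^ i := by
          exact_mod_cast Nat.sum_range_choose i
        rw [this]; ring

lemma tail_bd {n : ℕ} {φ : ℕ → Sch n} (hφ : SmoothResolution n φ) (ψ : Sch n) (m : ℕ) :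
    ∃ C : ℝ, 0 ≤ C ∧ ∀ j, nrm m (mulS ψ (φ j)) ≤ C * (1 / 2) ^ j := by
  obtain ⟨B, hB0, hB⟩ := res_bd hφ m
  have hn := nrm_nonneg (m + 1) ψ
  refine ⟨2 ^ m * (2 * (2 ^ (m + 1) * nrm (m + 1) ψ)) * B, by positivity, fun j => ?_⟩
  apply nrm_le _ _ _ (by positivity)
  intro k hk i hi x
  by_cases hx : 2 * ‖x‖ < 2 ^ j ∧ 0 < j
  · have h0 : (⇑(mulS ψ (φ j))) =ᶠ[𝓝 x] fun _ => 0 := by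
      have ho : IsOpen {y : Rn n | 2 * ‖y‖ < 2 ^ j} := isOpen_lt (by fun_prop) (by fun_prop)
      filter_upwards [ho.mem_nhds hx.1] with y hy
      rw [mulS_apply, res_zero_lo hφ hy hx.2, mul_zero]
    rw [(h0.iteratedFDeriv ℝ i).eq_of_nhds]
    simp
    positivity
  · have h2 : (2:ℝ) ^ j ≤ 2 * (1 + ‖x‖) := by
      rw [not_and_or, not_lt, not_lt] at hx
      rcases hx with hx | hx
      · linarith
      · have : j = 0 := by omega
        subst this
        have := norm_nonneg x
        simp; linarith
    have hk1 : ∀ l ≤ i, ‖iteratedFDeriv ℝ l ψ x‖ ≤ 2 ^ (m + 1) * nrm (m + 1) ψ / (1 + ‖x‖) ^ (k + 1) := by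
      intro l hl
      rw [le_div_iff₀ (by positivity), mul_comm]
      exact le_nrm' (by omega) (by omega) ψ x
    have h3 := leib ψ (φ j) i x hk1 (fun l hl => hB j l (by omega) x)
    have hp : (0:ℝ) < 2 ^ j := by positivity
    calc _ ≤ (1 + ‖x‖) ^ k * (2 ^ i * (2 ^ (m + 1) * nrm (m + 1) ψ / (1 + ‖x‖) ^ (k + 1)) * B) := by
          gcongr; linarith
      _ = 2 ^ i * (2 ^ (m + 1) * nrm (m + 1) ψ) * B * (1 + ‖x‖)⁻¹ := by
          field_simp
          ring
      _ ≤ 2 ^ m * (2 ^ (m + 1) * nrm (m + 1) ψ) * B * (2 * (1 / 2) ^ j) := by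
          gcongr
          · norm_num
          · rw [inv_le_iff_one_le_mul₀ (by positivity), one_div, inv_pow]
            rw [mul_comm 2, mul_assoc, ← div_eq_inv_mul, one_le_div hp]
            exact h2
      _ = _ := by ring

lemma tail_nrm {n : ℕ} {φ : ℕ → Sch n} (hφ : SmoothResolution n φ) (ψ : Sch n) (m : ℕ) :
    ∃ C : ℝ, 0 ≤ C ∧ ∀ J, nrm m (ψ - ∑ j ∈ Finset.range J, mulS ψ (φ j)) ≤ C * (1 / 2) ^ J := by
  obtain ⟨C, hC0, hC⟩ := tail_bd hφ ψ m
  refine ⟨C * 2, by positivity, fun J => ?_⟩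
  apply nrm_le _ _ _ (by positivity)
  intro k hk i hi x
  obtain ⟨L, hL⟩ : ∃ L : ℕ, ‖x‖ < 2 ^ L := pow_unbounded_of_one_lt _ (by norm_num)
  have h0 : (⇑(ψ - ∑ j ∈ Finset.range J, mulS ψ (φ j))) =ᶠ[𝓝 x]
      fun y => ∑ j ∈ Finset.Ico J (L + 1 + J), mulS ψ (φ j) y := by
    have ho : IsOpen {y : Rn n | ‖y‖ < 2 ^ L} := isOpen_lt (by fun_prop) (by fun_prop)
    filter_upwards [ho.mem_nhds hL] with y hy
    have h1 := res_part hφ (L + J) y (hy.trans_le (pow_le_pow_right₀ (by norm_num) (by omega)))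
    rw [show L + J + 1 = L + 1 + J by ring, ← Finset.sum_range_add_sum_Ico _ (show J ≤ L + 1 + J by omega)] at h1
    have e : (ψ - ∑ j ∈ Finset.range J, mulS ψ (φ j)) y = ψ y - ∑ j ∈ Finset.range J, ψ y * φ j y := by
      simp [mulS_apply]
    rw [e]
    simp_rw [mulS_apply]
    rw [← Finset.mul_sum, ← Finset.mul_sum, eq_sub_of_add_eq' h1]
    ring
  rw [(h0.iteratedFDeriv ℝ i).eq_of_nhds,
    iteratedFDeriv_fun_sum_apply (fun j _ => ((mulS ψ (φ j)).smooth _).contDiffAt)]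
  calc _ ≤ ‖x‖ ^ k * ∑ j ∈ Finset.Ico J (L + 1 + J), ‖iteratedFDeriv ℝ i (mulS ψ (φ j)) x‖ := by
        gcongr; exact norm_sum_le _ _
    _ ≤ ∑ j ∈ Finset.Ico J (L + 1 + J), C * (1 / 2) ^ j := by
        rw [Finset.mul_sum]
        exact Finset.sum_le_sum fun j _ => (le_nrm hk hi _ x).trans (hC j)
    _ ≤ C * ((1 / 2) ^ J * 2) := by
        rw [← Finset.mul_sum]
        gcongr
        have := geom_sum_Ico_le_of_lt_one (x := (1 / 2 : ℝ)) (m := J) (n := L + 1 + J) (by norm_num) (by norm_num)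
        refine this.trans (le_of_eq ?_)
        ring
    _ = _ := by ring

lemma res_sum_le {n : ℕ} {E : Type*} [NormedAddCommGroup E] [NormedSpace ℂ E] {φ : ℕ → Sch n}
    (hφ : SmoothResolution n φ) (ψ : Sch n) (f : TDist n E) (x : Rn n) :
    ‖mOp ψ f x‖ₑ ≤ ∑' j, ‖mOp (mulS ψ (φ j)) f x‖ₑ := by
  obtain ⟨m, D, hD0, hD⟩ := clm_bd (mOpL f x)
  obtain ⟨C, hC0, hC⟩ := tail_nrm hφ ψ m
  have key : ∀ J : ℕ, ‖mOp ψ f x‖ₑ ≤ (∑' j, ‖mOp (mulS ψ (φ j)) f x‖ₑ) +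
      ENNReal.ofReal (D * (C * (1 / 2) ^ J)) := by
    intro J
    have e : mOp ψ f x = (∑ j ∈ Finset.range J, mOp (mulS ψ (φ j)) f x) +
        mOpL f x (ψ - ∑ j ∈ Finset.range J, mulS ψ (φ j)) := by
      rw [map_sub, map_sum]
      simp only [mOpL_apply]
      abel
    rw [e]
    refine (enorm_add_le _ _).trans (add_le_add ?_ ?_)
    · exact (enorm_sum_le _ _).trans (ENNReal.sum_le_tsum _)
    · rw [← ofReal_norm]
      apply ENNReal.ofReal_le_ofReal
      refine (hD _).trans ?_
      gcongr
      exact hC J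
  have hlim : Tendsto (fun J : ℕ => (∑' j, ‖mOp (mulS ψ (φ j)) f x‖ₑ) +
      ENNReal.ofReal (D * (C * (1 / 2) ^ J))) atTop (𝓝 ((∑' j, ‖mOp (mulS ψ (φ j)) f x‖ₑ) + ENNReal.ofReal (D * (C * 0)))) := by
    apply Tendsto.const_add
    apply ENNReal.tendsto_ofReal
    apply Tendsto.const_mul
    apply Tendsto.const_mul
    exact tendsto_pow_atTop_nhds_zero_of_lt_one (by norm_num) (by norm_num)
  simp only [mul_zero, ENNReal.ofReal_zero, add_zero] at hlim
  exact ge_of_tendsto' hlim key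

end BP

namespace BP

lemma taylor0 {n : ℕ} (ψ : Sch n) (N : ℕ) (h0 : ∀ i < N, iteratedFDeriv ℝ i ψ 0 = 0) (d : ℕ) :
    ∀ i, N - i = d → ∃ C : ℝ, 0 ≤ C ∧ ∀ x, ‖iteratedFDeriv ℝ i ψ x‖ ≤ C * ‖x‖ ^ d := by
  induction d with
  | zero =>
    intro i _
    refine ⟨nrm i ψ, nrm_nonneg _ _, fun x => ?_⟩
    simpa using le_nrm (Nat.zero_le i) le_rfl ψ x
  | succ d ih =>
    intro i hi
    obtain ⟨C, hC0, hC⟩ := ih (i + 1) (by omega)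
    refine ⟨C, hC0, fun x => ?_⟩
    have := Convex.norm_image_sub_le_of_norm_fderiv_le (𝕜 := ℝ) (f := iteratedFDeriv ℝ i ψ)
      (s := closedBall (0 : Rn n) ‖x‖) (C := C * ‖x‖ ^ d) (x := 0) (y := x)
      (fun y _ => (ψ.smooth ⊤).differentiable_iteratedFDeriv (m := i)
        (by exact_mod_cast WithTop.coe_lt_top _) y)
      (fun y hy => by
        rw [norm_fderiv_iteratedFDeriv]
        refine (hC y).trans ?_
        rw [mem_closedBall_zero_iff] at hy
        gcongr) (convex_closedBall _ _) (by simp) (by simp)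
    rw [h0 i (by omega), sub_zero, sub_zero] at this
    rw [pow_succ, ← mul_assoc]
    exact this

lemma near_bd {n : ℕ} (ψ : Sch n) (N : ℕ) (h0 : ∀ i < N, iteratedFDeriv ℝ i ψ 0 = 0) (m : ℕ) :
    ∃ A : ℝ, 0 ≤ A ∧ ∀ t : ℝ, 0 < t → t ≤ 1 → ∀ k ≤ m, ∀ x : Rn n, ‖x‖ ≤ 4 →
      ‖iteratedFDeriv ℝ k (dilate ψ t) x‖ ≤ A * t ^ N := by
  choose C hC0 hC using fun i => taylor0 ψ N h0 (N - i) i rfl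
  refine ⟨∑ k ∈ Finset.range (m + 1), C k * 4 ^ N, Finset.sum_nonneg fun k _ => by
    have := hC0 k; positivity, ?_⟩
  intro t ht ht1 k hk x hx
  rw [dil_deriv _ ht]
  have hCk := hC0 k
  calc _ ≤ t ^ k * (C k * ‖t • x‖ ^ (N - k)) := by gcongr; exact hC k _
    _ = t ^ k * (C k * (t * ‖x‖) ^ (N - k)) := by rw [norm_smul, Real.norm_of_nonneg ht.le]
    _ ≤ t ^ k * (C k * (t * 4) ^ (N - k)) := by gcongr
    _ = C k * 4 ^ (N - k) * t ^ (k + (N - k)) := by rw [mul_pow, pow_add]; ring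
    _ ≤ C k * 4 ^ N * t ^ N := by
        have e1 : t ^ (k + (N - k)) ≤ t ^ N := pow_le_pow_of_le_one ht.le ht1 (by omega)
        have e2 : (4:ℝ) ^ (N - k) ≤ 4 ^ N := pow_le_pow_right₀ (by norm_num) (by omega)
        exact mul_le_mul (mul_le_mul_of_nonneg_left e2 hCk) e1 (by positivity) (by positivity)
    _ ≤ _ := by
        gcongr
        exact Finset.single_le_sum (f := fun k => C k * 4 ^ N) (fun k _ => by
          have := hC0 k; positivity) (Finset.mem_range.2 (by omega))

lemma far_bd {n : ℕ} (ψ : Sch n) (M : ℕ) (m : ℕ) :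
    ∃ A : ℝ, 0 ≤ A ∧ ∀ T : ℝ, 1 ≤ T → ∀ k ≤ m, ∀ x : Rn n, 1 / 4 ≤ ‖x‖ →
      ‖iteratedFDeriv ℝ k (dilate ψ T) x‖ ≤ A * T⁻¹ ^ M := by
  have hn := nrm_nonneg (M + m) ψ
  refine ⟨4 ^ (M + m) * nrm (M + m) ψ, by positivity, ?_⟩
  intro T hT k hk x hx
  have hT0 : 0 < T := by linarith
  rw [dil_deriv _ hT0, inv_pow, ← div_eq_mul_inv, le_div_iff₀ (by positivity)]
  have h1 := le_nrm (m := M + m) (k := M + k) (i := k) (by omega) (by omega) ψ (T • x)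
  have h2 : T / 4 ≤ ‖T • x‖ := by
    rw [norm_smul, Real.norm_of_nonneg hT0.le]; nlinarith
  have h3 : (T / 4) ^ (M + k) * ‖iteratedFDeriv ℝ k ψ (T • x)‖ ≤ nrm (M + m) ψ :=
    le_trans (by gcongr) h1
  calc _ = 4 ^ (M + k) * ((T / 4) ^ (M + k) * ‖iteratedFDeriv ℝ k ψ (T • x)‖) := by
        rw [div_pow, pow_add]; field_simp; ring
    _ ≤ _ := by
        gcongr
        norm_num

lemma const_bd {n : ℕ} (ψ : Sch n) (m : ℕ) {t : ℝ} (ht : 0 < t) (ht1 : t ≤ 2) (k : ℕ) (hk : k ≤ m)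
    (x : Rn n) : ‖iteratedFDeriv ℝ k (dilate ψ t) x‖ ≤ 2 ^ m * nrm m ψ := by
  have hn := nrm_nonneg m ψ
  rw [dil_deriv _ ht]
  have h1 := le_nrm (m := m) (k := 0) (i := k) (by omega) (by omega) ψ (t • x)
  rw [pow_zero, one_mul] at h1
  have : t ^ k ≤ 2 ^ m := (pow_le_pow_left₀ ht.le ht1 k).trans (pow_le_pow_right₀ (by norm_num) hk)
  gcongr

/-- the multiplier family -/
def mm {n : ℕ} (Ψ ψ : Sch n) (l : ℕ) : Sch n := if l = 0 then Ψ else dilate ψ ((2:ℝ) ^ l)⁻¹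

/-- decay coefficients -/
def kap (N M l j : ℕ) : ℝ := if j ≤ l then ((1 / 2 : ℝ) ^ (l - j)) ^ N else ((1 / 2 : ℝ) ^ (j - l)) ^ M

lemma kap_nonneg (N M l j : ℕ) : 0 ≤ kap N M l j := by
  unfold kap; split_ifs <;> positivity

lemma dilate_dilate {n : ℕ} (ψ : Sch n) {t u : ℝ} (ht : t ≠ 0) (hu : u ≠ 0) :
    dilate (dilate ψ t) u = dilate ψ (t * u) := by
  ext x
  rw [dilate_apply _ hu, dilate_apply _ ht, dilate_apply _ (mul_ne_zero ht hu), smul_smul]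

lemma dilate_inv {n : ℕ} (ψ : Sch n) {t : ℝ} (ht : t ≠ 0) : dilate (dilate ψ t) t⁻¹ = ψ := by
  ext x
  rw [dilate_dilate _ ht (inv_ne_zero ht), mul_inv_cancel₀ ht, dilate_apply _ one_ne_zero, one_smul]

lemma dilate_mulS {n : ℕ} (u v : Sch n) {t : ℝ} (ht : t ≠ 0) :
    dilate (mulS u v) t = mulS (dilate u t) (dilate v t) := by
  ext x
  simp only [dilate_apply _ ht, mulS_apply]

lemma kap_bd {n : ℕ} {φ : ℕ → Sch n} (hφ : SmoothResolution n φ) (Ψ ψ : Sch n) (N M : ℕ)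
    (h0 : ∀ i < N, iteratedFDeriv ℝ i ψ 0 = 0) (m : ℕ) :
    ∃ A : ℝ, 0 ≤ A ∧ ∀ l j, nrm m (mulS (dilate (mm Ψ ψ l) (2 ^ j)) (dilate (tt φ j) (2 ^ j))) ≤
      A * kap N M l j := by
  obtain ⟨A1, hA1, h1⟩ := near_bd ψ N h0 m
  obtain ⟨A2, hA2, h2⟩ := far_bd ψ M m
  obtain ⟨A3, hA3, h3⟩ := far_bd Ψ M m
  obtain ⟨B, hB0, hB⟩ := tt_dil_bd hφ m
  have hn := nrm_nonneg m Ψ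
  set A4 := 2 ^ M * (2 ^ m * nrm m Ψ)
  have hA4 : 0 ≤ A4 := by positivity
  set A := A1 + A2 + A3 + A4
  have hA : 0 ≤ A := by positivity
  refine ⟨4 ^ m * 2 ^ m * A * B, by positivity, fun l j => ?_⟩
  have hk := kap_nonneg N M l j
  have hcl4 : IsClosed (closedBall (0 : Rn n) 4) := isClosed_closedBall
  have hclA : IsClosed {x : Rn n | ‖x‖ ≤ 4 ∧ 1 / 4 ≤ ‖x‖} :=
    (isClosed_le (f := fun x : Rn n => ‖x‖) (g := fun _ => (4:ℝ)) (by fun_prop) (by fun_prop)).inter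
      (isClosed_le (f := fun _ : Rn n => (1 / 4 : ℝ)) (g := fun x => ‖x‖) (by fun_prop) (by fun_prop))
  suffices H : nrm m (mulS (dilate (mm Ψ ψ l) (2 ^ j)) (dilate (tt φ j) (2 ^ j))) ≤
      4 ^ m * 2 ^ m * (A * kap N M l j) * B by
    refine H.trans (le_of_eq ?_); ring
  have near : (∀ k ≤ m, ∀ x : Rn n, ‖x‖ ≤ 4 → ‖iteratedFDeriv ℝ k (dilate (mm Ψ ψ l) (2 ^ j)) x‖ ≤
      A * kap N M l j) → nrm m (mulS (dilate (mm Ψ ψ l) (2 ^ j)) (dilate (tt φ j) (2 ^ j))) ≤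
      4 ^ m * 2 ^ m * (A * kap N M l j) * B := fun H =>
    mul_nrm m _ _ _ hcl4 (fun x hx => mem_closedBall_zero_iff.2 (tt_dil_supp hφ j x hx).1) (by norm_num)
      (fun x hx => mem_closedBall_zero_iff.1 hx) (by positivity) hB0
      (fun k hk x hx => H k hk x (mem_closedBall_zero_iff.1 hx)) (hB j)
  have far : 2 ≤ j → (∀ k ≤ m, ∀ x : Rn n, 1 / 4 ≤ ‖x‖ → ‖iteratedFDeriv ℝ k (dilate (mm Ψ ψ l) (2 ^ j)) x‖ ≤
      A * kap N M l j) → nrm m (mulS (dilate (mm Ψ ψ l) (2 ^ j)) (dilate (tt φ j) (2 ^ j))) ≤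
      4 ^ m * 2 ^ m * (A * kap N M l j) * B := fun hj H =>
    mul_nrm m _ _ _ hclA (fun x hx => ⟨(tt_dil_supp hφ j x hx).1, (tt_dil_supp hφ j x hx).2 hj⟩) (by norm_num)
      (fun x hx => hx.1) (by positivity) hB0
      (fun k hk x hx => H k hk x hx.2) (hB j)
  rcases Nat.eq_zero_or_pos l with rfl | hl
  · have e : mm Ψ ψ 0 = Ψ := by simp [mm]
    rw [e] at *
    rcases le_or_gt 2 j with hj | hj
    · apply far hj
      intro k hk x hx
      refine (h3 (2 ^ j) (one_le_pow₀ (by norm_num)) k hk x hx).trans ?_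
      have : kap N M 0 j = ((2:ℝ) ^ j)⁻¹ ^ M := by
        simp [kap, show j ≠ 0 by omega]
      rw [this]
      gcongr
      linarith
    · apply near
      intro k hk x hx
      refine (const_bd Ψ m (by positivity) ?_ k hk x).trans ?_
      · calc (2:ℝ) ^ j ≤ 2 ^ 1 := pow_le_pow_right₀ (by norm_num) (by omega)
          _ = 2 := by norm_num
      · have hkap : (2 ^ M)⁻¹ ≤ kap N M 0 j := by
          have hM1 : ((2:ℝ) ^ M)⁻¹ ≤ 1 := inv_le_one_of_one_le₀ (one_le_pow₀ (by norm_num))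
          rcases (show j = 0 ∨ j = 1 by omega) with rfl | rfl <;> simp [kap]
          simpa using hM1
        calc 2 ^ m * nrm m Ψ = A4 * (2 ^ M)⁻¹ := by
              simp only [A4]; field_simp
          _ ≤ A * kap N M 0 j := by
              gcongr
              linarith
  · have e : dilate (mm Ψ ψ l) (2 ^ j) = dilate ψ (((2:ℝ) ^ l)⁻¹ * 2 ^ j) := by
      rw [mm, if_neg (by omega), dilate_dilate _ (by positivity) (by positivity)]
    rcases le_or_gt j l with hj | hj
    · apply near
      have e2 : ((2:ℝ) ^ l)⁻¹ * 2 ^ j = (1 / 2) ^ (l - j) := by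
        rw [one_div, inv_pow, pow_sub₀ _ (by norm_num) hj, mul_inv, inv_inv]
      intro k hk x hx
      rw [e, e2]
      refine (h1 _ (by positivity) (pow_le_one₀ (by norm_num) (by norm_num)) k hk x hx).trans ?_
      rw [kap, if_pos hj]
      gcongr
      linarith
    · apply far (by omega)
      have e2 : ((2:ℝ) ^ l)⁻¹ * 2 ^ j = 2 ^ (j - l) := by
        rw [pow_sub₀ _ (by norm_num) hj.le, mul_comm]
      intro k hk x hx
      rw [e, e2]
      refine (h2 _ (one_le_pow₀ (by norm_num)) k hk x hx).trans ?_
      rw [kap, if_neg (by omega), one_div, inv_pow 2 (j - l)]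
      gcongr
      linarith

end BP

namespace BP

lemma B1 {n : ℕ} {a : ℝ} (ha : 0 ≤ a) {φ : ℕ → Sch n} (hφ : SmoothResolution n φ) (Ψ ψ : Sch n) (N M : ℕ)
    (h0 : ∀ i < N, iteratedFDeriv ℝ i ψ 0 = 0) :
    ∃ C : ℝ, 0 ≤ C ∧ ∀ (E : Type*) [NormedAddCommGroup E] [NormedSpace ℂ E] [CompleteSpace E]
      (f : TDist n E) (l : ℕ) (x : Rn n), peetreMax a (2 ^ l) (mOp (mm Ψ ψ l) f) x ≤
        ∑' j, ENNReal.ofReal (C * (kap N M l j * ((2:ℝ) ^ (j - l)) ^ a)) *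
          peetreMax a (2 ^ j) (mOp (φ j) f) x := by
  obtain ⟨m, C, hC0, hC⟩ := W_bd (n := n) ha
  obtain ⟨A, hA0, hA⟩ := kap_bd hφ Ψ ψ N M h0 m
  refine ⟨C * A, by positivity, ?_⟩
  intro E _ _ _ f l x
  apply peetre_le a (by positivity)
  intro y
  refine (res_sum_le hφ _ f _).trans ?_
  rw [← ENNReal.tsum_mul_right]
  refine ENNReal.tsum_le_tsum fun j => ?_
  have hp : ((2:ℝ) ^ j) ≠ 0 := by positivity
  have e : mulS (mm Ψ ψ l) (φ j) = mulS (dilate (mulS (dilate (mm Ψ ψ l) (2 ^ j)) (dilate (tt φ j) (2 ^ j)))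
      ((2:ℝ) ^ j)⁻¹) (φ j) := by
    rw [← dilate_mulS _ _ hp, dilate_inv _ hp]
    conv_lhs => rw [← tt_mul hφ j]
    ext ξ
    simp only [mulS_apply, mul_assoc]
  rw [e]
  refine (hC E _ (φ j) f (2 ^ j) (by positivity) x y).trans ?_
  rw [mul_right_comm (ENNReal.ofReal _), ← ENNReal.ofReal_mul (by have := kap_nonneg N M l j; positivity)]
  refine mul_le_mul_left (ENNReal.ofReal_le_ofReal ?_) _
  have h1 : (1 + 2 ^ j * ‖y‖) ^ a ≤ ((2:ℝ) ^ (j - l)) ^ a * (1 + 2 ^ l * ‖y‖) ^ a := by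
    rw [← Real.mul_rpow (by positivity) (by positivity)]
    apply Real.rpow_le_rpow (by positivity) _ ha
    have h2 : (1:ℝ) ≤ 2 ^ (j - l) := one_le_pow₀ (by norm_num)
    have h3 : (2:ℝ) ^ j ≤ 2 ^ (j - l) * 2 ^ l := by
      rw [← pow_add]
      exact pow_le_pow_right₀ (by norm_num) (by omega)
    rw [mul_add, ← mul_assoc]
    have := norm_nonneg y
    nlinarith
  have hk := kap_nonneg N M l j
  calc C * nrm m _ * (1 + 2 ^ j * ‖y‖) ^ a ≤ C * (A * kap N M l j) * (((2:ℝ) ^ (j - l)) ^ a * (1 + 2 ^ l * ‖y‖) ^ a) := by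
        gcongr
        exact hA l j
    _ = _ := by ring

lemma tt_nrm {n : ℕ} {φ : ℕ → Sch n} (hφ : SmoothResolution n φ) (m : ℕ) :
    ∃ D : ℝ, 0 ≤ D ∧ ∀ j, nrm m (dilate (tt φ j) (2 ^ j)) ≤ D := by
  obtain ⟨B, hB0, hB⟩ := tt_dil_bd hφ m
  refine ⟨4 ^ m * B, by positivity, fun j => ?_⟩
  apply nrm_le _ _ _ (by positivity)
  intro k hk i hi x
  by_cases hx : ‖x‖ ≤ 4
  · gcongr
    · exact (pow_le_pow_left₀ (norm_nonneg _) hx k).trans (pow_le_pow_right₀ (by norm_num) hk)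
    · exact hB j i hi x
  · have h0 : (⇑(dilate (tt φ j) (2 ^ j))) =ᶠ[𝓝 x] fun _ => 0 := by
      have ho : IsOpen {y : Rn n | 4 < ‖y‖} := isOpen_lt (by fun_prop) (by fun_prop)
      filter_upwards [ho.mem_nhds (not_le.1 hx)] with y hy
      by_contra hh
      exact absurd (tt_dil_supp hφ j y hh).1 (not_le.2 hy)
    rw [(h0.iteratedFDeriv ℝ i).eq_of_nhds]
    simp
    positivity

lemma B2 {n : ℕ} {p : ℝ≥0∞} (hp : 0 < p) {a : ℝ} (ha : (n : ℝ) / p.toReal < a) {φ : ℕ → Sch n}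
    (hφ : SmoothResolution n φ) :
    ∃ C : ℝ≥0∞, C ≠ ∞ ∧ ∀ (E : Type*) [NormedAddCommGroup E] [NormedSpace ℂ E] [CompleteSpace E]
      (f : TDist n E) (j : ℕ), lpNormENN p (peetreMax a (2 ^ j) (mOp (φ j) f)) ≤
        C * eLpNorm (mOp (φ j) f) p volume := by
  obtain ⟨r, hr⟩ := peetre_Lp (n := n) hp ha
  have key : ∀ b : ℝ, ∃ A : ℝ≥0∞, A ≠ ∞ ∧ ∀ (E : Type _) [NormedAddCommGroup E] [NormedSpace ℂ E] [CompleteSpace E]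
      (f : TDist n E) (j : ℕ) (x : Rn n), ‖mOp (φ j) f x‖ₑ ≤ A * ∫⁻ z, kern b (2 ^ j) z * ‖mOp (φ j) f (x - z)‖ₑ := by
    intro b
    obtain ⟨m, C, hC0, hC⟩ := V_bd (n := n) b
    obtain ⟨D, hD0, hD⟩ := tt_nrm hφ m
    refine ⟨ENNReal.ofReal (C * D), ENNReal.ofReal_ne_top, ?_⟩
    intro E _ _ _ f j x
    have hp : ((2:ℝ) ^ j) ≠ 0 := by positivity
    have h := hC E (dilate (tt φ j) (2 ^ j)) (φ j) f (2 ^ j) (by positivity) x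
    rw [dilate_inv _ hp, tt_mul hφ] at h
    refine h.trans (mul_le_mul_left (ENNReal.ofReal_le_ofReal ?_) _)
    gcongr
    exact hD j
  obtain ⟨A, hA, hA'⟩ := key r
  obtain ⟨C, hC, hC'⟩ := hr A hA
  refine ⟨C, hC, ?_⟩
  intro E _ _ _ f j
  apply hC' E (mOp (φ j) f) (2 ^ j) (by positivity) (mOp_cont _ _)
  · obtain ⟨m, hm⟩ := mOp_growth f
    obtain ⟨D, hD, h⟩ := hm (φ j)
    exact ⟨m, D, hD, h⟩
  · intro b
    obtain ⟨A', h1, h2⟩ := key b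
    exact ⟨A', h1, fun x => h2 E f j x⟩
  · exact fun x => hA' E f j x

end BP

namespace BP

open scoped Manifold ContDiff in
lemma inv_fam {n : ℕ} {ι : Type} (s : Finset ι) (g : ι → Sch n) (Z : Set (Rn n)) (hZ : IsClosed Z)
    {R : ℝ} (hR : ∀ x ∈ Z, ‖x‖ ≤ R) (h : ∀ ξ ∈ Z, ∃ i ∈ s, g i ξ ≠ 0) :
    ∃ u : ι → Sch n, ∀ ξ ∈ Z, ∑ i ∈ s, u i ξ * g i ξ = 1 := by
  set H : Rn n → ℝ := fun x => ∑ i ∈ s, ‖g i x‖ ^ 2 with hH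
  have hHs : ContDiff ℝ ∞ H := by
    apply ContDiff.sum
    intro i _
    exact ((g i).smooth _).norm_sq ℝ
  have hHc : Continuous H := hHs.continuous
  have hH0 : ∀ x, 0 ≤ H x := fun x => Finset.sum_nonneg fun i _ => by positivity
  have hHZ : ∀ x ∈ Z, 0 < H x := by
    intro x hx
    obtain ⟨i, hi, hne⟩ := h x hx
    exact Finset.sum_pos' (fun i _ => by positivity) ⟨i, hi, by positivity⟩
  have hA : IsClosed ({x : Rn n | H x ≤ 0} ∪ {x | R + 1 ≤ ‖x‖}) :=
    (isClosed_le hHc continuous_const).union (isClosed_le continuous_const continuous_norm)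
  have hd : Disjoint ({x : Rn n | H x ≤ 0} ∪ {x | R + 1 ≤ ‖x‖}) Z := by
    rw [Set.disjoint_left]
    rintro x (hx | hx) hxZ
    · exact absurd (hHZ x hxZ) (not_lt.2 hx)
    · have := hR x hxZ
      simp only [Set.mem_ofPred_eq] at hx
      linarith
  obtain ⟨f, hf0, hf1, hf⟩ := exists_contMDiffMap_zero_one_of_isClosed (n := (⊤ : ℕ∞)) 𝓘(ℝ, Rn n) hA hZ hd
  have hfs : ContDiff ℝ ∞ f := f.contMDiff.contDiff
  have hD : ∀ x, 0 < H x + (1 - f x) := by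
    intro x
    by_cases hx : H x ≤ 0
    · have : f x = 0 := hf0 (Or.inl hx)
      rw [this]; linarith [hH0 x]
    · linarith [(hf x).2]
  have hsm : ∀ i, ContDiff ℝ ∞ (fun x => ((f x / (H x + (1 - f x)) : ℝ) : ℂ) * (starRingEnd ℂ) (g i x)) := by
    intro i
    apply ContDiff.mul
    · exact Complex.ofRealCLM.contDiff.comp (hfs.div (hHs.add (contDiff_const.sub hfs)) fun x => (hD x).ne')
    · exact Complex.conjCLE.contDiff.comp ((g i).smooth _)
  have hcs : ∀ i, HasCompactSupport (fun x => ((f x / (H x + (1 - f x)) : ℝ) : ℂ) * (starRingEnd ℂ) (g i x)) := by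
    intro i
    apply HasCompactSupport.intro (isCompact_closedBall (0 : Rn n) (R + 1))
    intro x hx
    have : f x = 0 := hf0 (Or.inr (by
      rw [mem_closedBall_zero_iff, not_le] at hx; exact hx.le))
    simp [this]
  refine ⟨fun i => (hcs i).toSchwartzMap (hsm i), fun ξ hξ => ?_⟩
  have e1 : f ξ = 1 := hf1 hξ
  change ∑ i ∈ s, (((f ξ / (H ξ + (1 - f ξ)) : ℝ) : ℂ) * (starRingEnd ℂ) (g i ξ)) * g i ξ = 1
  have e2 : ∀ i, (((f ξ / (H ξ + (1 - f ξ)) : ℝ) : ℂ) * (starRingEnd ℂ) (g i ξ)) * g i ξ =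
      (((H ξ)⁻¹ * ‖g i ξ‖ ^ 2 : ℝ) : ℂ) := by
    intro i
    rw [mul_assoc, mul_comm (starRingEnd ℂ _), Complex.mul_conj, Complex.normSq_eq_norm_sq, e1]
    push_cast
    simp
  simp_rw [e2]
  rw [← Complex.ofReal_sum, ← Finset.mul_sum]
  rw [inv_mul_cancel₀ (hHZ ξ hξ).ne']
  simp

lemma scale_ex {ε : ℝ} (hε : 0 < ε) (L : ℕ) : ∀ c : ℝ, ε ≤ c → c ≤ 2 ^ L * ε →
    ∃ k ≤ L, ε / 2 < ((2:ℝ) ^ k)⁻¹ * c ∧ ((2:ℝ) ^ k)⁻¹ * c < 2 * ε := by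
  induction L with
  | zero =>
    intro c h1 h2
    refine ⟨0, le_rfl, ?_, ?_⟩ <;> simp at * <;> linarith
  | succ L ih =>
    intro c h1 h2
    by_cases hc : c < 2 * ε
    · refine ⟨0, by omega, ?_, ?_⟩ <;> simp <;> linarith
    · obtain ⟨k, hk, h3, h4⟩ := ih (c / 2) (by linarith) (by rw [pow_succ] at h2; linarith)
      have e : ((2:ℝ) ^ (k + 1))⁻¹ * c = ((2:ℝ) ^ k)⁻¹ * (c / 2) := by
        rw [pow_succ, mul_inv]; ring
      exact ⟨k + 1, by omega, by rw [e]; exact h3, by rw [e]; exact h4⟩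

lemma mOp_sum {n : ℕ} {E : Type*} [NormedAddCommGroup E] [NormedSpace ℂ E] {ι : Type} (s : Finset ι)
    (u : ι → Sch n) (f : TDist n E) (x : Rn n) :
    ‖mOp (∑ i ∈ s, u i) f x‖ₑ ≤ ∑ i ∈ s, ‖mOp (u i) f x‖ₑ := by
  rw [← mOpL_apply, map_sum]
  exact enorm_sum_le _ _

lemma Abd {n : ℕ} {a : ℝ} (ha : 0 ≤ a) {φ : ℕ → Sch n} (hφ : SmoothResolution n φ)
    {ε : ℝ} (hε : 0 < ε) (Ψ ψ : Sch n)
    (hΨ : ∀ x : Rn n, ‖x‖ < 2 * ε → 0 < ‖Ψ x‖)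
    (hψ : ∀ x : Rn n, ε / 2 < ‖x‖ → ‖x‖ < 2 * ε → 0 < ‖ψ x‖) :
    ∃ (C : ℝ) (K : ℕ), 0 ≤ C ∧ ∀ l, ∃ T : Finset ℕ, (∀ j ∈ T, nd l j ≤ K) ∧
      ∀ (E : Type*) [NormedAddCommGroup E] [NormedSpace ℂ E] [CompleteSpace E]
      (f : TDist n E) (x : Rn n), ‖mOp (φ l) f x‖ₑ ≤
        ∑ j ∈ T, ENNReal.ofReal C * peetreMax a (2 ^ j) (mOp (mm Ψ ψ j) f) x := by
  obtain ⟨m, C, hC0, hC⟩ := W_bd (n := n) ha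
  obtain ⟨K, hK⟩ : ∃ K : ℕ, max (2 * ε) (2 / ε) < 2 ^ K := pow_unbounded_of_one_lt _ (by norm_num)
  have hK1 : 2 * ε < 2 ^ K := (le_max_left _ _).trans_lt hK
  have hK2 : 2 < 2 ^ K * ε := by
    have := (le_max_right _ _).trans_lt hK
    rwa [div_lt_iff₀ hε] at this
  -- first family
  obtain ⟨u, hu⟩ := inv_fam (Finset.range (2 * K + 1)) (fun k => dilate ψ (2 ^ K * ((2:ℝ) ^ k)⁻¹))
    {x : Rn n | ‖x‖ ≤ 2 ∧ 1 / 2 ≤ ‖x‖}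
    ((isClosed_le (f := fun x : Rn n => ‖x‖) (g := fun _ => (2:ℝ)) (by fun_prop) (by fun_prop)).inter
      (isClosed_le (f := fun _ : Rn n => (1 / 2 : ℝ)) (g := fun x => ‖x‖) (by fun_prop) (by fun_prop)))
    (R := 2) (fun x hx => hx.1) (by
      rintro ξ ⟨h1, h2⟩
      obtain ⟨k, hk, h3, h4⟩ := scale_ex hε (2 * K) (2 ^ K * ‖ξ‖) (by nlinarith) (by
        rw [two_mul, pow_add]
        have : (0:ℝ) < 2 ^ K := by positivity
        nlinarith)
      refine ⟨k, Finset.mem_range.2 (by omega), ?_⟩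
      rw [dilate_apply _ (by positivity), ← norm_pos_iff]
      have e : ‖((2:ℝ) ^ K * ((2:ℝ) ^ k)⁻¹) • ξ‖ = ((2:ℝ) ^ k)⁻¹ * (2 ^ K * ‖ξ‖) := by
        rw [norm_smul, Real.norm_of_nonneg (by positivity)]; ring
      apply hψ <;> rw [e] <;> assumption)
  -- second family
  obtain ⟨v, hv⟩ := inv_fam (Finset.range (2 * K + 2)) (fun k => mm Ψ ψ k)
    (closedBall (0 : Rn n) (2 ^ (K + 1))) isClosed_closedBall
    (R := 2 ^ (K + 1)) (fun x hx => mem_closedBall_zero_iff.1 hx) (by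
      intro ξ hξ
      rw [mem_closedBall_zero_iff] at hξ
      by_cases h : ‖ξ‖ < 2 * ε
      · refine ⟨0, by simp, ?_⟩
        rw [← norm_pos_iff]
        simpa [mm] using hΨ ξ h
      · obtain ⟨k, hk, h3, h4⟩ := scale_ex hε (2 * K) (‖ξ‖ / 2) (by linarith) (by
          rw [two_mul, pow_add]
          rw [pow_succ] at hξ
          have : (0:ℝ) < 2 ^ K := by positivity
          nlinarith)
        refine ⟨k + 1, Finset.mem_range.2 (by omega), ?_⟩
        rw [mm, if_neg (by omega), dilate_apply _ (by positivity), ← norm_pos_iff]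
        have e : ‖((2:ℝ) ^ (k + 1))⁻¹ • ξ‖ = ((2:ℝ) ^ k)⁻¹ * (‖ξ‖ / 2) := by
          rw [norm_smul, Real.norm_of_nonneg (by positivity), pow_succ, mul_inv]; ring
        apply hψ <;> rw [e] <;> assumption)
  obtain ⟨B, hB0, hB⟩ := dil_bd hφ m
  set A := ∑ k ∈ Finset.range (2 * K + 1), nrm m (u k) with hA
  have hA0 : 0 ≤ A := Finset.sum_nonneg fun k _ => nrm_nonneg _ _
  set A2 := ∑ l ∈ Finset.range (K + 1), ∑ k ∈ Finset.range (2 * K + 2), nrm m (mulS (v k) (φ l)) with hA2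
  have hA20 : 0 ≤ A2 := Finset.sum_nonneg fun k _ => Finset.sum_nonneg fun k _ => nrm_nonneg _ _
  set D := 2 ^ m * 2 ^ m * A * B + A2 with hD
  have hD0 : 0 ≤ D := by positivity
  have piece : ∀ (E : Type _) [NormedAddCommGroup E] [NormedSpace ℂ E] [CompleteSpace E]
      (f : TDist n E) (x : Rn n) (M : Sch n) (l j : ℕ), nrm m M ≤ D → j ≤ l + (2 * K + 1) →
      ‖mOp (mulS (dilate M ((2:ℝ) ^ l)⁻¹) (mm Ψ ψ j)) f x‖ₑ ≤
      ENNReal.ofReal (C * D * ((2:ℝ) ^ (2 * K + 1)) ^ a) * peetreMax a (2 ^ j) (mOp (mm Ψ ψ j) f) x := by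
    intro E _ _ _ f x M l j hM hj
    have h1 := hC E M (mm Ψ ψ j) f (2 ^ l) (by positivity) x 0
    rw [sub_zero, norm_zero, mul_zero, add_zero, Real.one_rpow, mul_one] at h1
    refine h1.trans ?_
    have e : ENNReal.ofReal (C * D * ((2:ℝ) ^ (2 * K + 1)) ^ a) =
        ENNReal.ofReal (C * D) * ENNReal.ofReal (((2:ℝ) ^ (2 * K + 1)) ^ a) :=
      ENNReal.ofReal_mul (by positivity)
    rw [e, mul_assoc]
    refine mul_le_mul' (ENNReal.ofReal_le_ofReal (mul_le_mul_of_nonneg_left hM hC0)) ?_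
    apply peetre_scale ha (by positivity) (by positivity) (one_le_pow₀ (by norm_num))
    rw [← pow_add]
    exact pow_le_pow_right₀ (by norm_num) (by omega)
  refine ⟨C * D * ((2:ℝ) ^ (2 * K + 1)) ^ a, 3 * K + 2, by positivity, fun l => ?_⟩
  rcases le_or_gt l K with hl | hl
  · refine ⟨Finset.range (2 * K + 2), ?_, ?_⟩
    · intro j hj
      rw [Finset.mem_range] at hj
      unfold nd; omega
    · intro E _ _ _ f x
      have e : φ l = ∑ k ∈ Finset.range (2 * K + 2), mulS (dilate (mulS (v k) (φ l)) ((2:ℝ) ^ 0)⁻¹) (mm Ψ ψ k) := by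
        ext ξ
        rw [sum_apply]
        simp only [mulS_apply]
        simp only [pow_zero, inv_one, dilate_apply _ one_ne_zero, one_smul, mulS_apply]
        by_cases h : φ l ξ = 0
        · simp [h]
        have hξ : ξ ∈ closedBall (0 : Rn n) (2 ^ (K + 1)) := by
          rw [mem_closedBall_zero_iff]
          by_contra hh
          apply h
          apply res_zero_hi hφ
          exact (pow_le_pow_right₀ (by norm_num) (by omega)).trans (not_le.1 hh).le
        have := hv ξ hξ
        calc φ l ξ = φ l ξ * ∑ k ∈ Finset.range (2 * K + 2), v k ξ * mm Ψ ψ k ξ := by rw [this, mul_one]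
          _ = _ := by
            rw [Finset.mul_sum]
            refine Finset.sum_congr rfl fun k _ => ?_
            ring
      conv_lhs => rw [e]
      refine (mOp_sum _ _ f x).trans (Finset.sum_le_sum fun k hk => ?_)
      apply piece E f x _ 0 k
      · have h1 : nrm m (mulS (v k) (φ l)) ≤ ∑ k ∈ Finset.range (2 * K + 2), nrm m (mulS (v k) (φ l)) :=
          Finset.single_le_sum (f := fun k => nrm m (mulS (v k) (φ l))) (fun _ _ => nrm_nonneg _ _) hk
        have h2 : ∑ k ∈ Finset.range (2 * K + 2), nrm m (mulS (v k) (φ l)) ≤ A2 :=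
          Finset.single_le_sum (f := fun l => ∑ k ∈ Finset.range (2 * K + 2), nrm m (mulS (v k) (φ l)))
            (fun _ _ => Finset.sum_nonneg fun _ _ => nrm_nonneg _ _) (Finset.mem_range.2 (by omega))
        have : 0 ≤ 2 ^ m * 2 ^ m * A * B := by positivity
        linarith
      · rw [Finset.mem_range] at hk; omega
  · refine ⟨(Finset.range (2 * K + 1)).map (addLeftEmbedding (l - K)), ?_, ?_⟩
    · intro j hj
      rw [Finset.mem_map] at hj
      obtain ⟨k, hk, rfl⟩ := hj
      rw [Finset.mem_range] at hk
      simp only [addLeftEmbedding_apply]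
      unfold nd; omega
    · intro E _ _ _ f x
      have hp : (2:ℝ) ^ l ≠ 0 := by positivity
      have e : φ l = ∑ k ∈ Finset.range (2 * K + 1),
          mulS (dilate (mulS (u k) (dilate (φ l) (2 ^ l))) ((2:ℝ) ^ l)⁻¹) (mm Ψ ψ (l - K + k)) := by
        ext ξ
        rw [sum_apply]
        simp only [mulS_apply]
        simp only [dilate_mulS _ _ (inv_ne_zero hp), dilate_inv _ hp, mulS_apply]
        by_cases h : φ l ξ = 0
        · simp [h]
        have hn : ‖((2:ℝ) ^ l)⁻¹ • ξ‖ = ((2:ℝ) ^ l)⁻¹ * ‖ξ‖ := by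
          rw [norm_smul, Real.norm_of_nonneg (by positivity)]
        have hξ : ((2:ℝ) ^ l)⁻¹ • ξ ∈ {x : Rn n | ‖x‖ ≤ 2 ∧ 1 / 2 ≤ ‖x‖} := by
          simp only [Set.mem_ofPred_eq, hn]
          constructor
          · rw [inv_mul_le_iff₀ (by positivity)]
            by_contra hh
            apply h
            apply res_zero_hi hφ
            rw [pow_succ]; exact (not_le.1 hh).le
          · rw [← div_eq_inv_mul, le_div_iff₀ (by positivity)]
            by_contra hh
            apply h
            apply res_zero_lo hφ _ (by omega)
            linarith [not_le.1 hh]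
        have := hu _ hξ
        calc φ l ξ = φ l ξ * ∑ k ∈ Finset.range (2 * K + 1), u k (((2:ℝ) ^ l)⁻¹ • ξ) *
              dilate ψ (2 ^ K * ((2:ℝ) ^ k)⁻¹) (((2:ℝ) ^ l)⁻¹ • ξ) := by rw [this, mul_one]
          _ = _ := by
            rw [Finset.mul_sum]
            refine Finset.sum_congr rfl fun k _ => ?_
            rw [mm, if_neg (by omega), dilate_apply _ (by positivity), dilate_apply _ (by positivity),
              dilate_apply _ (by positivity), smul_smul]
            have e3 : (2:ℝ) ^ K * ((2:ℝ) ^ k)⁻¹ * ((2:ℝ) ^ l)⁻¹ = ((2:ℝ) ^ (l - K + k))⁻¹ := by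
              rw [pow_add, pow_sub₀ _ (by norm_num) hl.le]
              field_simp
            rw [e3]
            ring
      conv_lhs => rw [e]
      refine (mOp_sum _ _ f x).trans ?_
      rw [Finset.sum_map]
      refine Finset.sum_le_sum fun k hk => ?_
      simp only [addLeftEmbedding_apply]
      apply piece E f x _ l (l - K + k)
      · have h1 : nrm m (u k) ≤ A := Finset.single_le_sum (f := fun k => nrm m (u k)) (fun _ _ => nrm_nonneg _ _) hk
        have h2 : nrm m (mulS (u k) (dilate (φ l) (2 ^ l))) ≤ 2 ^ m * 2 ^ m * A * B := by
          apply mul_nrm m _ _ (closedBall 0 2) isClosed_closedBall _ (by norm_num)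
            (fun x hx => mem_closedBall_zero_iff.1 hx) hA0 hB0
          · intro i hi x _
            have := le_nrm (Nat.zero_le m) hi (u k) x
            rw [pow_zero, one_mul] at this
            exact this.trans h1
          · exact fun i hi x => hB l l (by omega) i hi x
          · intro x hx
            rw [dilate_apply _ hp] at hx
            rw [mem_closedBall_zero_iff]
            by_contra hh
            apply hx
            apply res_zero_hi hφ
            rw [norm_smul, Real.norm_of_nonneg (by positivity), pow_succ]
            gcongr
            exact (not_le.1 hh).le
        linarith
      · rw [Finset.mem_range] at hk; omega

end BP

namespace BP

lemma w_eq (t : ℝ) : (2 : ℝ≥0∞) ^ t = ENNReal.ofReal ((2:ℝ) ^ t) := by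
  rw [← ENNReal.ofReal_rpow_of_pos (by norm_num)]
  simp

lemma wseq {p q : ℝ≥0∞} (hp : 0 < p) (hq : 0 < q) (s : ℝ) {δ : ℝ} (hδ : 0 < δ) {C : ℝ} (hC : 0 ≤ C) :
    ∃ D : ℝ≥0∞, D ≠ ∞ ∧ ∀ {n : ℕ} (a b : ℕ → Rn n → ℝ≥0∞), (∀ j, Measurable (a j)) →
      (∀ l x, b l x ≤ ∑' j, ENNReal.ofReal (C * ((2:ℝ) ^ (-δ * (nd l j : ℝ)) *
        (2:ℝ) ^ (((j:ℝ) - l) * s))) * a j x) →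
      lqSum q (fun l => (2 : ℝ≥0∞) ^ ((l:ℝ) * s) * lpNormENN p (b l)) ≤
        D * lqSum q (fun j => (2 : ℝ≥0∞) ^ ((j:ℝ) * s) * lpNormENN p (a j)) := by
  have hr : ENNReal.ofReal ((2:ℝ) ^ (-δ)) < 1 := by
    rw [ENNReal.ofReal_lt_one]
    exact Real.rpow_lt_one_of_one_lt_of_neg (by norm_num) (by linarith)
  obtain ⟨D, hD, h⟩ := seq_bd hp hq hr
  refine ⟨D * ENNReal.ofReal C, ENNReal.mul_ne_top hD ENNReal.ofReal_ne_top, fun {n} a b ha hb => ?_⟩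
  have hw : ∀ t : ℝ, (2 : ℝ≥0∞) ^ t ≠ ∞ := fun t => by rw [w_eq]; exact ENNReal.ofReal_ne_top
  have := h (fun j x => (ENNReal.ofReal C * (2 : ℝ≥0∞) ^ ((j:ℝ) * s)) * a j x)
    (fun l x => (2 : ℝ≥0∞) ^ ((l:ℝ) * s) * b l x) (fun j => (ha j).const_mul _) (by
      intro l x
      refine (mul_le_mul' le_rfl (hb l x)).trans ?_
      rw [← ENNReal.tsum_mul_left]
      refine ENNReal.tsum_le_tsum fun j => ?_
      rw [← mul_assoc, ← mul_assoc (ENNReal.ofReal _ ^ nd l j)]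
      refine mul_le_mul' (le_of_eq ?_) le_rfl
      rw [w_eq, w_eq, ← ENNReal.ofReal_pow (by positivity), ← ENNReal.ofReal_mul (by positivity),
        ← ENNReal.ofReal_mul (by positivity), ← ENNReal.ofReal_mul (by positivity)]
      congr 1
      rw [← Real.rpow_natCast, ← Real.rpow_mul (by norm_num)]
      have : (2:ℝ) ^ ((j:ℝ) * s) = (2:ℝ) ^ ((l:ℝ) * s) * (2:ℝ) ^ (((j:ℝ) - l) * s) := by
        rw [← Real.rpow_add (by norm_num)]; ring_nf
      rw [this]; ring)
  simp only [lp_const hp (hw _), lp_const hp (ENNReal.mul_ne_top ENNReal.ofReal_ne_top (hw _))] at this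
  refine this.trans (le_of_eq ?_)
  simp only [mul_assoc]
  rw [lqSum_const _ hq]

lemma kap_le {N M : ℕ} {a s δ : ℝ} (hN : δ ≤ N - s) (hM : δ + a - s ≤ M) (l j : ℕ) :
    kap N M l j * ((2:ℝ) ^ (j - l)) ^ a ≤ (2:ℝ) ^ (-δ * (nd l j : ℝ)) * (2:ℝ) ^ (((j:ℝ) - l) * s) := by
  have e1 : ∀ k m : ℕ, ((1 / 2 : ℝ) ^ k) ^ m = (2:ℝ) ^ (-((k:ℝ) * m)) := by
    intro k m
    rw [Real.rpow_neg (by norm_num), ← Nat.cast_mul, Real.rpow_natCast, pow_mul, one_div, inv_pow, inv_pow]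
  have e2 : ∀ k : ℕ, ((2:ℝ) ^ k) ^ a = (2:ℝ) ^ ((k:ℝ) * a) := by
    intro k
    rw [← Real.rpow_natCast, ← Real.rpow_mul (by norm_num)]
  unfold kap nd
  rw [e2, ← Real.rpow_add (by norm_num)]
  split_ifs with h
  · rw [e1, ← Real.rpow_add (by norm_num)]
    apply Real.rpow_le_rpow_of_exponent_le (by norm_num)
    rw [Nat.sub_eq_zero_of_le h]
    push_cast [Nat.cast_sub h]
    have : (j:ℝ) ≤ l := by exact_mod_cast h
    nlinarith
  · have h := (not_le.1 h).le
    rw [e1, ← Real.rpow_add (by norm_num)]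
    apply Real.rpow_le_rpow_of_exponent_le (by norm_num)
    rw [Nat.sub_eq_zero_of_le h]
    push_cast [Nat.cast_sub h]
    have : (l:ℝ) ≤ j := by exact_mod_cast h
    nlinarith

lemma one_le_w {K : ℕ} (s : ℝ) {l j : ℕ} (h : nd l j ≤ K) :
    1 ≤ (2:ℝ) ^ ((K:ℝ) * (1 + |s|)) * ((2:ℝ) ^ (-1 * (nd l j : ℝ)) * (2:ℝ) ^ (((j:ℝ) - l) * s)) := by
  rw [← Real.rpow_add (by norm_num), ← Real.rpow_add (by norm_num)]
  apply Real.one_le_rpow (by norm_num)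
  have hK : (nd l j : ℝ) ≤ K := by exact_mod_cast h
  have hd : |(j:ℝ) - l| ≤ nd l j := by
    unfold nd
    rcases le_total l j with h | h
    · rw [Nat.sub_eq_zero_of_le h, abs_of_nonneg (by simpa using h)]
      push_cast [Nat.cast_sub h]; linarith
    · rw [Nat.sub_eq_zero_of_le h, abs_of_nonpos (by simpa using h)]
      push_cast [Nat.cast_sub h]; linarith
  have h1 : -(((j:ℝ) - l) * s) ≤ K * |s| := by
    refine (neg_le_abs _).trans ?_
    rw [abs_mul]
    exact mul_le_mul_of_nonneg_right (hd.trans hK) (abs_nonneg _)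
  nlinarith

lemma peetreNorm_eq {n : ℕ} {E : Type*} [NormedAddCommGroup E] [NormedSpace ℂ E]
    (s : ℝ) (p q : ℝ≥0∞) (a : ℝ) (Ψ ψ : Sch n) (f : TDist n E) :
    besovPeetreNorm s p q a Ψ ψ f =
      (2 : ℝ≥0∞) ^ (((0:ℕ):ℝ) * s) * lpNormENN p (peetreMax a (2 ^ 0) (mOp (mm Ψ ψ 0) f)) +
      lqSum q (fun j => (2 : ℝ≥0∞) ^ (((j + 1 : ℕ) : ℝ) * s) *
        lpNormENN p (peetreMax a (2 ^ (j + 1)) (mOp (mm Ψ ψ (j + 1)) f))) := by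
  unfold besovPeetreNorm
  have e : ∀ j : ℕ, (2:ℝ) ^ ((j:ℝ) + 1) = 2 ^ (j + 1) := by
    intro j
    rw [← Real.rpow_natCast]; push_cast; rfl
  have e2 : ∀ j : ℕ, (2:ℝ) ^ (-((j:ℝ) + 1)) = (2 ^ (j + 1))⁻¹ := by
    intro j
    rw [Real.rpow_neg (by norm_num), e]
  simp only [e, e2, mm, Nat.cast_zero, zero_mul, ENNReal.rpow_zero, one_mul, pow_zero, if_true,
    Nat.add_eq_zero_iff, one_ne_zero, and_false, if_false, Nat.cast_add, Nat.cast_one]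

lemma main {n : ℕ} (E : Type*) [NormedAddCommGroup E] [NormedSpace ℂ E]
    [CompleteSpace E] (s : ℝ) (p q : ℝ≥0∞) (hp : 0 < p) (hq : 0 < q)
    (a : ℝ) (ha : (n : ℝ) / p.toReal < a)
    (S : ℤ) (hS : -1 ≤ S) (hSs : ⌊s⌋ ≤ S)
    (ε : ℝ) (hε : 0 < ε) (Ψ ψ : Sch n)
    (hΨ : ∀ x : Rn n, ‖x‖ < 2 * ε → 0 < ‖Ψ x‖)
    (hψ : ∀ x : Rn n, ε / 2 < ‖x‖ → ‖x‖ < 2 * ε → 0 < ‖ψ x‖)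
    (hmom : ∀ α : Fin n → ℕ, (mdeg α : ℤ) ≤ S → mderiv α (fun y => ψ y) 0 = 0)
    (φ : ℕ → Sch n) (hφ : SmoothResolution n φ) :
    ∃ D₁ D₂ : ℝ≥0∞, D₁ ≠ ∞ ∧ D₂ ≠ ∞ ∧ ∀ f : TDist n E,
      besovNorm s p q φ f ≤ D₁ * besovPeetreNorm s p q a Ψ ψ f ∧
      besovPeetreNorm s p q a Ψ ψ f ≤ D₂ * besovNorm s p q φ f := by
  have ha0 : 0 ≤ a := le_trans (by positivity) ha.le
  obtain ⟨N, hN⟩ : ∃ N : ℕ, (N : ℤ) = S + 1 := ⟨(S + 1).toNat, by omega⟩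
  have hNs : s < N := by
    have h1 := Int.lt_floor_add_one s
    have h2 : (⌊s⌋ : ℝ) + 1 ≤ N := by
      have : ⌊s⌋ + 1 ≤ (N : ℤ) := by omega
      exact_mod_cast this
    linarith
  have h0 : ∀ i < N, iteratedFDeriv ℝ i ψ 0 = 0 := by
    intro i hi
    rw [← norm_le_zero_iff]
    refine (iterated_le i ψ 0).trans (le_of_eq ?_)
    refine Finset.sum_eq_zero fun r _ => ?_
    rw [hmom _ (by rw [mdeg_cnt]; omega), norm_zero]
  obtain ⟨M, hM⟩ := exists_nat_ge (1 + a - s)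
  have hδ : 0 < min 1 ((N:ℝ) - s) := lt_min one_pos (by linarith)
  obtain ⟨C1, hC10, hC1⟩ := B1 ha0 hφ Ψ ψ N M h0
  obtain ⟨C2, hC2t, hC2⟩ := B2 hp ha hφ
  obtain ⟨C3, K, hC30, hC3⟩ := Abd ha0 hφ hε Ψ ψ hΨ hψ
  obtain ⟨C4, hC4t, hC4⟩ := lqSum_split hq
  obtain ⟨D1, hD1t, hD1⟩ := wseq hp hq s hδ hC10
  obtain ⟨D2, hD2t, hD2⟩ := wseq hp hq s one_pos
    (show (0:ℝ) ≤ C3 * (2:ℝ) ^ ((K:ℝ) * (1 + |s|)) by positivity)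
  refine ⟨D2 * C4, 2 * (D1 * C2), ENNReal.mul_ne_top hD2t hC4t,
    ENNReal.mul_ne_top (by simp) (ENNReal.mul_ne_top hD1t hC2t), fun f => ⟨?_, ?_⟩⟩
  · have h1 := hD2 (fun j => peetreMax a (2 ^ j) (mOp (mm Ψ ψ j) f)) (fun l x => ‖mOp (φ l) f x‖ₑ)
      (fun j => peetre_meas _ _ _ (mOp_cont _ _) (by positivity)) (by
        intro l x
        obtain ⟨T, hT, hb⟩ := hC3 l
        refine (hb E f x).trans ((Finset.sum_le_sum fun j hj => ?_).trans (ENNReal.sum_le_tsum T))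
        refine mul_le_mul_left (ENNReal.ofReal_le_ofReal ?_) _
        rw [mul_assoc]
        exact le_mul_of_one_le_right hC30 (one_le_w s (hT j hj)))
    simp only [lp_enorm hp] at h1
    rw [peetreNorm_eq]
    refine h1.trans ?_
    rw [mul_assoc]
    exact mul_le_mul_right (hC4 (fun j => (2 : ℝ≥0∞) ^ ((j:ℝ) * s) *
      lpNormENN p (peetreMax a (2 ^ j) (mOp (mm Ψ ψ j) f)))).2 _
  · have h1 := hD1 (fun j => peetreMax a (2 ^ j) (mOp (φ j) f))
      (fun l => peetreMax a (2 ^ l) (mOp (mm Ψ ψ l) f))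
      (fun j => peetre_meas _ _ _ (mOp_cont _ _) (by positivity)) (by
        intro l x
        refine (hC1 E f l x).trans (ENNReal.tsum_le_tsum fun j => ?_)
        refine mul_le_mul_left (ENNReal.ofReal_le_ofReal (mul_le_mul_of_nonneg_left ?_ hC10)) _
        exact kap_le (min_le_right _ _) (by linarith [min_le_left 1 ((N:ℝ) - s)]) l j)
    rw [peetreNorm_eq]
    refine (hC4 (fun j => (2 : ℝ≥0∞) ^ ((j:ℝ) * s) *
      lpNormENN p (peetreMax a (2 ^ j) (mOp (mm Ψ ψ j) f)))).1.trans ?_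
    rw [mul_assoc 2]
    refine mul_le_mul_right (h1.trans ?_) _
    rw [mul_assoc]
    refine mul_le_mul_right ?_ _
    unfold besovNorm
    rw [← lqSum_const _ hq]
    refine lqSum_mono fun j => ?_
    rw [mul_left_comm]
    exact mul_le_mul_right (hC2 E f j) _

lemma final {α : Type*} {F G : α → ℝ≥0∞} {D₁ D₂ : ℝ≥0∞} (h1 : D₁ ≠ ∞) (h2 : D₂ ≠ ∞)
    (h : ∀ f, F f ≤ D₁ * G f ∧ G f ≤ D₂ * F f) :
    (∃ c₁ > (0 : ℝ), ∃ c₂ > (0 : ℝ), ∀ f, F f < ∞ →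
      ENNReal.ofReal c₁ * F f ≤ G f ∧ G f ≤ ENNReal.ofReal c₂ * F f) ∧
    ∀ f, F f < ∞ ↔ G f < ∞ := by
  have hle : ∀ D : ℝ≥0∞, D ≠ ∞ → D ≤ ENNReal.ofReal (D.toReal + 1) := by
    intro D hD
    conv_lhs => rw [← ENNReal.ofReal_toReal hD]
    exact ENNReal.ofReal_le_ofReal (by linarith)
  refine ⟨⟨(D₁.toReal + 1)⁻¹, by positivity, D₂.toReal + 1, by positivity, fun f _ => ⟨?_, ?_⟩⟩, fun f => ⟨?_, ?_⟩⟩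
  · rw [ENNReal.ofReal_inv_of_pos (by positivity), ENNReal.inv_mul_le_iff (by simp; positivity) (by simp)]
    exact (h f).1.trans (mul_le_mul_left (hle _ h1) _)
  · exact (h f).2.trans (mul_le_mul_left (hle _ h2) _)
  · exact fun hf => (h f).2.trans_lt (ENNReal.mul_lt_top h2.lt_top hf)
  · exact fun hf => (h f).1.trans_lt (ENNReal.mul_lt_top h1.lt_top hf)

end BP

/-- characterization of `B^s_{p,q}(E)` via the Peetre maximal functions
`(Ψ^*f)_a` and `(ψ_j^*f)_a` for `a > n/p`. -/
theorem statement1 (n : ℕ) (E : Type*) [NormedAddCommGroup E] [NormedSpace ℂ E]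
    [CompleteSpace E] (s : ℝ) (p q : ℝ≥0∞) (hp : 0 < p) (hq : 0 < q)
    (a : ℝ) (ha : (n : ℝ) / p.toReal < a)
    (S : ℤ) (hS : -1 ≤ S) (hSs : ⌊s⌋ ≤ S)
    (ε : ℝ) (hε : 0 < ε) (Ψ ψ : Sch n)
    (hΨ : ∀ x : Rn n, ‖x‖ < 2 * ε → 0 < ‖Ψ x‖)
    (hψ : ∀ x : Rn n, ε / 2 < ‖x‖ → ‖x‖ < 2 * ε → 0 < ‖ψ x‖)
    (hmom : ∀ α : Fin n → ℕ, (mdeg α : ℤ) ≤ S → mderiv α (fun y => ψ y) 0 = 0)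
    (φ : ℕ → Sch n) (hφ : SmoothResolution n φ) :
    (∃ c₁ > (0 : ℝ), ∃ c₂ > (0 : ℝ), ∀ f : TDist n E, besovNorm s p q φ f < ∞ →
      ENNReal.ofReal c₁ * besovNorm s p q φ f ≤ besovPeetreNorm s p q a Ψ ψ f ∧
        besovPeetreNorm s p q a Ψ ψ f ≤ ENNReal.ofReal c₂ * besovNorm s p q φ f) ∧
    ∀ f : TDist n E, besovNorm s p q φ f < ∞ ↔ besovPeetreNorm s p q a Ψ ψ f < ∞ := by
  obtain ⟨D₁, D₂, h1, h2, h⟩ := BP.main E s p q hp hq a ha S hS hSs ε hε Ψ ψ hΨ hψ hmom φ hφ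
  exact BP.final h1 h2 h

end
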